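/- arXiv:2508.00302 — 8 statements merged into one kernel-verified Lean document; each statement's English description precedes it below -/
import Mathlib

section
/- Let A be the adjacency matrix of a connected, non-complete, inhomogeneous, 6-regular and 2 net-regular strongly regular signed graph with parameters (n, 6, a, b, c) lying in the class C1 ∪ C4 ∪ C5 which contains an unbalanced triangle of the first type. Then (a, b) ≠ (-2, 3); and if (a, b) = (-1, 3), then n = 9, c = -2, and the underlying simple graph of A (with adjacency relation A i j ≠ 0) is isomorphic to the complete tripartite graph K_{3,3,3}. -/
/-- Six-regular, `2` net-regular strongly regular signed graphs with `b = 3`, `-2 ≤ a` and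
more than seven vertices. -/
structure IsSRSG {V : Type*} [Fintype V] (A : Matrix V V ℤ) (a c : ℤ) : Prop where
  symm : ∀ i j, A i j = A j i
  diag : ∀ i, A i i = 0
  ent : ∀ i j, A i j = -1 ∨ A i j = 0 ∨ A i j = 1
  card_pos : ∀ i, (Finset.univ.filter (fun j => A i j = 1)).card = 4
  card_neg : ∀ i, (Finset.univ.filter (fun j => A i j = -1)).card = 2
  sq_pos : ∀ i j, A i j = 1 → ∑ k, A i k * A k j = a
  sq_neg : ∀ i j, A i j = -1 → ∑ k, A i k * A k j = 3
  sq_non : ∀ i j, i ≠ j → A i j = 0 → ∑ k, A i k * A k j = c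
  lower : -2 ≤ a
  seven_lt : 7 < Fintype.card V

/-- The negative neighbours of `i` are `x, y` and its positive neighbours are `p, q, u, v`. -/
structure IsStar {V : Type*} [Fintype V] (A : Matrix V V ℤ) (i x y p q u v : V) : Prop where
  neg : ∀ k, A i k = -1 ↔ k = x ∨ k = y
  pos : ∀ k, A i k = 1 ↔ k = p ∨ k = q ∨ k = u ∨ k = v
  xy : x ≠ y
  pq : p ≠ q
  pu : p ≠ u
  pv : p ≠ v
  qu : q ≠ u
  qv : q ≠ v
  uv : u ≠ v
  sum : ∀ f : V → ℤ, ∑ k, A i k * f k = f p + f q + f u + f v - f x - f y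

theorem exists_equiv_sigma {V : Type*} [Fintype V] [DecidableEq V] (r : Setoid V)
    [DecidableRel r] {m : ℕ} (hr : ∀ x, (Finset.univ.filter (fun y => r x y)).card = m) :
    ∃ (k : ℕ) (e : V ≃ Σ _ : Fin k, Fin m), ∀ x y, r x y ↔ (e x).1 = (e y).1 := by
  classical
  have hc : ∀ q : Quotient r, Nonempty ({x // Quotient.mk r x = q} ≃ Fin m) := by
    intro q
    induction q using Quotient.inductionOn with
    | _ x =>
      refine ⟨Fintype.equivFinOfCardEq ?_⟩
      rw [Fintype.card_subtype, ← hr x]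
      congr 1
      ext y
      simp only [Finset.mem_filter, Finset.mem_univ, true_and, Quotient.eq]
      exact ⟨r.symm, r.symm⟩
  have g := fun q => (hc q).some
  let f := Fintype.equivFin (Quotient r)
  refine ⟨_, (Equiv.sigmaFiberEquiv (Quotient.mk r)).symm.trans
    (Equiv.sigmaCongr f g), ?_⟩
  intro x y
  change r x y ↔ f (Quotient.mk r x) = f (Quotient.mk r y)
  rw [f.injective.eq_iff, Quotient.eq]

namespace IsSRSG

variable {V : Type*} [Fintype V] {A : Matrix V V ℤ} {a c : ℤ}

theorem exists_isStar (h : IsSRSG A a c) (i : V) : ∃ x y p q u v, IsStar A i x y p q u v := by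
  classical
  obtain ⟨x, y, hxy, hn⟩ := Finset.card_eq_two.1 (h.card_neg i)
  obtain ⟨p, s, hps, hs, hs3⟩ := Finset.card_eq_succ.1 (h.card_pos i)
  obtain ⟨q, u, v, hqu, hqv, huv, rfl⟩ := Finset.card_eq_three.1 hs3
  simp only [Finset.mem_insert, Finset.mem_singleton, not_or] at hps
  obtain ⟨hpq, hpu, hpv⟩ := hps
  refine ⟨x, y, p, q, u, v, ?_, ?_, hxy, hpq, hpu, hpv, hqu, hqv, huv, ?_⟩
  · intro k
    have := Finset.ext_iff.1 hn k
    simpa using this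
  · intro k
    have := Finset.ext_iff.1 hs k
    simpa using this.symm
  · intro f
    have key : ∀ k, A i k * f k =
        (if A i k = 1 then f k else 0) - (if A i k = -1 then f k else 0) := by
      intro k
      rcases h.ent i k with e | e | e <;> simp [e]
    simp only [key, Finset.sum_sub_distrib, ← Finset.sum_filter, hn, ← hs]
    rw [Finset.sum_insert (by simp [hpq, hpu, hpv]), Finset.sum_insert (by simp [hqu, hqv]),
      Finset.sum_pair huv, Finset.sum_pair hxy]
    ring

theorem sum_abs (h : IsSRSG A a c) (i : V) : ∑ k, |A i k| = 6 := by
  obtain ⟨x, y, p, q, u, v, s⟩ := h.exists_isStar i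
  have key : ∀ k, |A i k| = A i k * A i k := by
    intro k
    rcases h.ent i k with e | e | e <;> simp [e]
  have e1 := s.sum (A i)
  rw [(s.neg x).2 (by simp), (s.neg y).2 (by simp), (s.pos p).2 (by simp), (s.pos q).2 (by simp),
    (s.pos u).2 (by simp), (s.pos v).2 (by simp)] at e1
  simp only [key, e1]
  norm_num

theorem sum_eq (h : IsSRSG A a c) (i : V) : ∑ k, A i k = 2 := by
  obtain ⟨x, y, p, q, u, v, s⟩ := h.exists_isStar i
  simpa using s.sum (fun _ => 1)

theorem mul_card_sub_seven (h : IsSRSG A a c) :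
    c * ((Fintype.card V : ℤ) - 7) = -8 - 4 * a := by
  classical
  obtain ⟨i⟩ := Fintype.card_pos_iff.1 (h.seven_lt.trans' (by norm_num))
  have e1 : ∑ j, ∑ k, A i k * A k j = 4 := by
    rw [Finset.sum_comm]
    simp only [← Finset.mul_sum, h.sum_eq, ← Finset.sum_mul]
    norm_num
  have e2 : ∀ j, ∑ k, A i k * A k j = (6 - c) * (if j = i then 1 else 0) +
      (a - c) * (if A i j = 1 then 1 else 0) + (3 - c) * (if A i j = -1 then 1 else 0) + c := by
    intro j
    by_cases hj : j = i
    · subst hj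
      rw [h.diag, ← h.sum_abs j]
      simp only [h.symm _ j]
      simp
      refine Finset.sum_congr rfl fun k _ => ?_
      rcases h.ent j k with e | e | e <;> simp [e]
    · rcases h.ent i j with e | e | e
      · simp [h.sq_neg i j e, e, hj]
      · simp [h.sq_non i j (Ne.symm hj) e, e, hj]
      · simp [h.sq_pos i j e, e, hj]
  simp only [e2, Finset.sum_add_distrib, ← Finset.mul_sum, ← Finset.sum_filter] at e1
  have e3 : Finset.univ.filter (fun j => j = i) = {i} := by ext; simp
  simp only [Finset.sum_const, h.card_pos, h.card_neg, e3, Finset.card_singleton, Finset.card_univ,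
    nsmul_eq_mul, mul_one] at e1
  push_cast at e1
  linarith

theorem nonpos (h : IsSRSG A a c) : c ≤ 0 := by
  have h1 := h.mul_card_sub_seven
  have h2 := h.lower
  have h3 : (7 : ℤ) < Fintype.card V := by exact_mod_cast h.seven_lt
  by_contra! hc
  nlinarith [mul_pos hc (sub_pos.2 h3)]

/-- Negative adjacency is transitive. -/
theorem neg_trans (h : IsSRSG A a c) {i x y : V} (hx : A i x = -1) (hy : A i y = -1)
    (hxy : x ≠ y) : A x y = -1 := by
  classical
  obtain ⟨x', y', p, q, u, v, s⟩ := h.exists_isStar i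
  wlog hxx : x = x' ∧ y = y' generalizing x' y'
  · have h1 := (s.neg x).1 hx
    have h2 := (s.neg y).1 hy
    refine this y' x' ⟨?_, s.pos, s.xy.symm, s.pq, s.pu, s.pv, s.qu, s.qv, s.uv, ?_⟩ ?_
    · intro k; rw [s.neg k, or_comm]
    · intro f; rw [s.sum]; ring
    · grind
  obtain ⟨rfl, rfl⟩ := hxx
  have e1 := h.sq_neg i x hx
  have e2 := h.sq_neg i y hy
  rw [s.sum (fun k => A k x), h.diag, h.symm y x] at e1
  rw [s.sum (fun k => A k y), h.diag] at e2
  have hp := (s.pos p).2 (by simp)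
  have hq := (s.pos q).2 (by simp)
  have hu := (s.pos u).2 (by simp)
  have hv := (s.pos v).2 (by simp)
  have hi := h.diag i
  have hdx := h.diag x
  have hdy := h.diag y
  have := s.pq; have := s.pu; have := s.pv; have := s.qu; have := s.qv; have := s.uv
  have bound : ∀ (f : V → ℤ) (z : V), (∀ k, 0 ≤ f k) → z ∉ ({p, q, u, v} : Finset V) →
      f z + (f p + f q + f u + f v) ≤ ∑ k, f k := by
    intro f z hf hz
    refine le_of_eq_of_le ?_ (Finset.sum_le_sum_of_subset_of_nonneg
      (Finset.subset_univ (insert z {p, q, u, v})) (fun k _ _ => hf k))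
    rw [Finset.sum_insert hz, Finset.sum_insert (by simp [*]), Finset.sum_insert (by simp [*]),
      Finset.sum_pair s.uv]
    ring
  rcases h.ent x y with e | e | e
  · exact e
  · exfalso
    have e3 := h.sq_non x y hxy e
    have hc := h.nonpos
    have e4 := bound (fun k => A x k * A k y + |A x k|) i (fun k => by
      rcases h.ent x k with e | e | e <;> rcases h.ent k y with e' | e' | e' <;> simp [e, e'])
      (by grind)
    rw [Finset.sum_add_distrib, e3, h.sum_abs] at e4
    simp only [h.symm x _, hx, hy] at e4
    have := h.ent p y; have := h.ent q y; have := h.ent u y; have := h.ent v y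
    rcases h.ent p x with e5 | e5 | e5 <;> rcases h.ent q x with e6 | e6 | e6 <;>
    rcases h.ent u x with e7 | e7 | e7 <;> rcases h.ent v x with e8 | e8 | e8 <;>
    simp only [e5, e6, e7, e8, e, abs_neg, abs_one, abs_zero] at e1 e2 e4 <;> omega
  · exfalso
    have e4 := bound (fun k => A x k + |A x k|) y (fun k => by
      rcases h.ent x k with e | e | e <;> simp [e]) (by grind)
    rw [Finset.sum_add_distrib, h.sum_eq, h.sum_abs] at e4
    simp only [h.symm x _] at e4
    rw [h.symm y x, e] at e4
    have := h.ent p x; have := h.ent q x; have := h.ent u x; have := h.ent v x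
    have e5 : A p x = 1 := by omega
    have e6 : A q x = 1 := by omega
    have e7 : A u x = 1 := by omega
    have e8 : A v x = 1 := by omega
    simp [e5, e6, e7, e8] at e4

/-- A positive neighbour of `i` is not negatively adjacent to a negative neighbour of `i`. -/
theorem eq_zero_or_eq_one (h : IsSRSG A a c) {i x p : V} (hx : A i x = -1) (hp : A i p = 1) :
    A p x = 0 ∨ A p x = 1 := by
  rcases h.ent p x with e | e
  · rw [h.symm] at hx e
    have := h.neg_trans hx e (by rintro rfl; simp [h.diag] at hp)
    omega
  · exact e

theorem exists_neg (h : IsSRSG A a c) {p q : V} (hpq : A p q = -1) :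
    ∃ r, r ≠ q ∧ A p r = -1 ∧ A q r = -1 := by
  obtain ⟨x, y, _, _, _, _, s⟩ := h.exists_isStar p
  have h1 := (s.neg q).1 hpq
  have hx := (s.neg x).2 (by simp)
  have hy := (s.neg y).2 (by simp)
  rcases h1 with rfl | rfl
  · exact ⟨y, s.xy.symm, hy, h.neg_trans hx hy s.xy⟩
  · exact ⟨x, s.xy, hx, h.neg_trans hy hx s.xy.symm⟩

theorem star_sums (h : IsSRSG A a c) {i x y p q u v : V} (s : IsStar A i x y p q u v) :
    (A p q + A p u + A p v - A p x - A p y = a ∧ A p q + A q u + A q v - A q x - A q y = a ∧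
      A p u + A q u + A u v - A u x - A u y = a ∧ A p v + A q v + A u v - A v x - A v y = a) ∧
    A p x + A q x + A u x + A v x = 2 ∧ A p y + A q y + A u y + A v y = 2 := by
  have hp := (s.pos p).2 (by simp)
  have hq := (s.pos q).2 (by simp)
  have hu := (s.pos u).2 (by simp)
  have hv := (s.pos v).2 (by simp)
  have hx := (s.neg x).2 (by simp)
  have hy := (s.neg y).2 (by simp)
  have e1 := h.sq_pos i p hp
  have e2 := h.sq_pos i q hq
  have e3 := h.sq_pos i u hu
  have e4 := h.sq_pos i v hv
  have e5 := h.sq_neg i x hx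
  have e6 := h.sq_neg i y hy
  have e7 := h.neg_trans hx hy s.xy
  simp only [s.sum (fun k => A k _), h.diag] at e1 e2 e3 e4 e5 e6
  have := h.symm p q; have := h.symm p u; have := h.symm p v
  have := h.symm q u; have := h.symm q v; have := h.symm u v
  have := h.symm p x; have := h.symm q x; have := h.symm u x; have := h.symm v x
  have := h.symm p y; have := h.symm q y; have := h.symm u y; have := h.symm v y
  have := h.symm x y
  omega

theorem star_split (h : IsSRSG A (-2) c) {i x y p q u v : V} (s : IsStar A i x y p q u v) :
    (A p q = -1 ∧ A u v = -1 ∧ A p u = 0 ∧ A p v = 0 ∧ A q u = 0 ∧ A q v = 0) ∨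
    (A p u = -1 ∧ A q v = -1 ∧ A p q = 0 ∧ A p v = 0 ∧ A q u = 0 ∧ A u v = 0) ∨
    (A p v = -1 ∧ A q u = -1 ∧ A p u = 0 ∧ A p q = 0 ∧ A u v = 0 ∧ A q v = 0) := by
  obtain ⟨⟨k1, k2, k3, k4⟩, k5, k6⟩ := h.star_sums s
  have hp := (s.pos p).2 (by simp)
  have hq := (s.pos q).2 (by simp)
  have hu := (s.pos u).2 (by simp)
  have hv := (s.pos v).2 (by simp)
  have hx := (s.neg x).2 (by simp)
  have hy := (s.neg y).2 (by simp)
  have px := h.eq_zero_or_eq_one hx hp; have qx := h.eq_zero_or_eq_one hx hq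
  have ux := h.eq_zero_or_eq_one hx hu; have vx := h.eq_zero_or_eq_one hx hv
  have py := h.eq_zero_or_eq_one hy hp; have qy := h.eq_zero_or_eq_one hy hq
  have uy := h.eq_zero_or_eq_one hy hu; have vy := h.eq_zero_or_eq_one hy hv
  have r0 : A p q + A p u + A p v + A q u + A q v + A u v = -2 := by
    clear px qx ux vx py qy uy vy; omega
  have r1 : A p q + A p u + A p v ≤ 0 := by clear qx ux vx qy uy vy; omega
  have r2 : A p q + A q u + A q v ≤ 0 := by clear px ux vx py uy vy; omega
  have r3 : A p u + A q u + A u v ≤ 0 := by clear px qx vx py qy vy; omega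
  have r4 : A p v + A q v + A u v ≤ 0 := by clear px qx ux py qy uy; omega
  clear k1 k2 k3 k4 k5 k6 px qx ux vx py qy uy vy
  have t : ∀ {k l m : V}, l ≠ m → A k l = -1 → A k m = -1 → A l m = -1 :=
    fun hlm h1 h2 => h.neg_trans h1 h2 hlm
  have t1 := t (k := p) s.qu; have t2 := t (k := p) s.qv; have t3 := t (k := p) s.uv
  have t4 := t (k := q) s.pu; have t5 := t (k := q) s.pv; have t6 := t (k := q) s.uv
  have t7 := t (k := u) s.pq; have t8 := t (k := u) s.pv; have t9 := t (k := u) s.qv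
  have t10 := t (k := v) s.pq; have t11 := t (k := v) s.pu; have t12 := t (k := v) s.qu
  rw [h.symm q p] at t4 t5
  rw [h.symm u p] at t7 t8
  rw [h.symm u q] at t7 t9
  rw [h.symm v p] at t10 t11
  rw [h.symm v q] at t10 t12
  rw [h.symm v u] at t11 t12
  have e1 := h.ent p q; have e2 := h.ent p u; have e3 := h.ent p v
  have e4 := h.ent q u; have e5 := h.ent q v; have e6 := h.ent u v
  generalize A p q = m1 at *; generalize A p u = m2 at *; generalize A p v = m3 at *
  generalize A q u = m4 at *; generalize A q v = m5 at *; generalize A u v = m6 at *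
  clear * - t1 t2 t3 t4 t5 t6 t7 t8 t9 t10 t11 t12 r0 r1 r2 r3 r4 e1 e2 e3 e4 e5 e6
  grind (splits := 40)

theorem exists_split_star (h : IsSRSG A (-2) c) (i : V) : ∃ x y p q u v, IsStar A i x y p q u v ∧
    A p q = -1 ∧ A u v = -1 ∧ A p u = 0 ∧ A p v = 0 ∧ A q u = 0 ∧ A q v = 0 := by
  obtain ⟨x, y, p, q, u, v, s⟩ := h.exists_isStar i
  rcases h.star_split s with e | ⟨e1, e2, e3, e4, e5, e6⟩ | ⟨e1, e2, e3, e4, e5, e6⟩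
  · exact ⟨x, y, p, q, u, v, s, e⟩
  · refine ⟨x, y, p, u, q, v, ⟨s.neg, fun k => ?_, s.xy, s.pu, s.pq, s.pv, s.qu.symm, s.uv, s.qv,
      fun f => ?_⟩, e1, e2, e3, e4, h.symm q u ▸ e5, e6⟩
    · rw [s.pos]; tauto
    · rw [s.sum]; ring
  · refine ⟨x, y, p, v, u, q, ⟨s.neg, fun k => ?_, s.xy, s.pv, s.pu, s.pq, s.uv.symm, s.qv.symm,
      s.qu.symm, fun f => ?_⟩, e1, h.symm q u ▸ e2, e3, e4, h.symm u v ▸ e5, h.symm q v ▸ e6⟩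
    · rw [s.pos]; tauto
    · rw [s.sum]; ring

theorem exists_partner (h : IsSRSG A (-2) c) {i w : V} (hw : A i w = 1) :
    ∃ z, A i z = 1 ∧ A w z = -1 := by
  obtain ⟨x, y, p, q, u, v, s, h1, h2, -⟩ := h.exists_split_star i
  rcases (s.pos w).1 hw with rfl | rfl | rfl | rfl
  · exact ⟨q, (s.pos q).2 (by simp), h1⟩
  · exact ⟨p, (s.pos p).2 (by simp), h.symm w p ▸ h1⟩
  · exact ⟨v, (s.pos v).2 (by simp), h2⟩
  · exact ⟨u, (s.pos u).2 (by simp), h.symm w u ▸ h2⟩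

theorem ne_neg_two (h : IsSRSG A a 0) : a ≠ -2 := by
  rintro rfl
  obtain ⟨i⟩ := Fintype.card_pos_iff.1 (h.seven_lt.trans' (by norm_num))
  obtain ⟨x, y, p, q, u, v, s, h1, h2, h3, h4, h5, h6⟩ := h.exists_split_star i
  obtain ⟨w, hwv, huw, hvw⟩ := h.exists_neg h2
  have hu := (s.pos u).2 (by simp)
  have hx := (s.neg x).2 (by simp)
  have hy := (s.neg y).2 (by simp)
  have hiw : i ≠ w := by
    rintro rfl
    rw [h.symm] at huw
    omega
  have hwi : A i w = 0 := by
    rcases h.ent i w with e | e | e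
    · rcases h.eq_zero_or_eq_one e hu with e' | e' <;> omega
    · exact e
    · rcases (s.pos w).1 e with rfl | rfl | rfl | rfl
      · rw [h.symm] at huw; omega
      · rw [h.symm] at huw; omega
      · rw [h.diag] at huw; omega
      · exact absurd rfl hwv
  have key := h.sq_non i w hiw hwi
  rw [s.sum (fun k => A k w)] at key
  have nn : ∀ z, A i z = -1 → 0 ≤ A z w := by
    intro z hz
    rcases h.ent z w with e | e | e
    · rw [h.symm] at hz
      have := h.neg_trans hz e hiw
      omega
    · exact e.ge
    · omega
  have hxw := nn x hx
  have hyw := nn y hy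
  have hqw := h.ent q w
  have hpw : A p w = 1 := by rcases h.ent p w with e | e | e <;> omega
  obtain ⟨z, hpz, hwz⟩ := h.exists_partner hpw
  obtain ⟨x', y', _, _, _, _, s'⟩ := h.exists_isStar w
  have hz : z = u ∨ z = v := by
    have k1 := (s'.neg z).1 hwz
    have k2 := (s'.neg u).1 (h.symm w u ▸ huw)
    have k3 := (s'.neg v).1 (h.symm w v ▸ hvw)
    have := s.uv
    grind
  rcases hz with rfl | rfl <;> omega

theorem nonadj_trans (h : IsSRSG A a (-2)) (hV : Fintype.card V = 9) {i s t : V} (his : i ≠ s)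
    (hit : i ≠ t) (hst : s ≠ t) (hs : A i s = 0) (ht : A i t = 0) : A s t = 0 := by
  classical
  obtain ⟨x, y, p, q, u, v, st⟩ := h.exists_isStar i
  have hp := (st.pos p).2 (by simp)
  have hq := (st.pos q).2 (by simp)
  have hu := (st.pos u).2 (by simp)
  have hv := (st.pos v).2 (by simp)
  have hx := (st.neg x).2 (by simp)
  have hy := (st.neg y).2 (by simp)
  have hi := h.diag i
  have := st.xy; have := st.pq; have := st.pu; have := st.pv
  have := st.qu; have := st.qv; have := st.uv
  have hnd : [i, s, t, x, y, p, q, u, v].Nodup := by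
    simp only [List.nodup_cons, List.mem_cons, List.not_mem_nil, or_false, not_or,
      List.nodup_nil, not_false_eq_true, and_true]
    refine ⟨⟨?_, ?_, ?_, ?_, ?_, ?_, ?_, ?_⟩, ⟨?_, ?_, ?_, ?_, ?_, ?_, ?_⟩,
      ⟨?_, ?_, ?_, ?_, ?_, ?_⟩, ⟨?_, ?_, ?_, ?_, ?_⟩, ⟨?_, ?_, ?_, ?_⟩, ⟨?_, ?_, ?_⟩, ⟨?_, ?_⟩, ?_⟩
      <;> grind
  have huniv : (Finset.univ : Finset V) = [i, s, t, x, y, p, q, u, v].toFinset := by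
    symm
    apply Finset.eq_univ_of_card
    rw [List.toFinset_card_of_nodup hnd, hV]
    rfl
  have e1 := h.sum_eq s
  rw [huniv, List.sum_toFinset _ hnd] at e1
  have e2 := h.sq_non i s his hs
  rw [st.sum (fun k => A k s)] at e2
  simp only [List.map_cons, List.map_nil, List.sum_cons, List.sum_nil, h.diag, h.symm s _, hs]
    at e1
  rw [h.symm s t]
  rcases h.ent t s with e | e | e <;> omega

theorem three_dvd_card (h : IsSRSG A a c) : 3 ∣ Fintype.card V := by
  classical
  let r : Setoid V :=
    { r := fun x y => x = y ∨ A x y = -1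
      iseqv := by
        refine ⟨fun _ => .inl rfl, ?_, ?_⟩
        · rintro x y (rfl | e)
          · exact .inl rfl
          · exact .inr (h.symm x y ▸ e)
        · rintro x y z (rfl | e) (rfl | e')
          · exact .inl rfl
          · exact .inr e'
          · exact .inr e
          · by_cases hxz : x = z
            · exact .inl hxz
            · exact .inr (h.neg_trans (h.symm x y ▸ e) e' hxz) }
  have hr : ∀ x, (Finset.univ.filter (fun y => r x y)).card = 3 := by
    intro x
    have : Finset.univ.filter (fun y => r x y) =
        insert x (Finset.univ.filter (fun y => A x y = -1)) := by
      ext y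
      simp only [Finset.mem_filter, Finset.mem_univ, true_and, Finset.mem_insert, eq_comm (a := y)]
      rfl
    rw [this, Finset.card_insert_of_notMem (by simp [h.diag]), h.card_neg]
  obtain ⟨k, e, -⟩ := exists_equiv_sigma r hr
  rw [Fintype.card_congr e]
  simp

theorem card_eq_nine (h : IsSRSG A (-1) c) : Fintype.card V = 9 ∧ c = -2 := by
  have h1 := h.mul_card_sub_seven
  have h2 := h.three_dvd_card
  have h3 := h.seven_lt
  have h4 : (Fintype.card V : ℤ) - 7 ≤ 4 := Int.le_of_dvd (by norm_num) ⟨-c, by linarith⟩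
  have h5 : Fintype.card V = 9 ∨ Fintype.card V = 8 ∨ Fintype.card V = 10 ∨
    Fintype.card V = 11 := by omega
  rcases h5 with e | e | e | e <;> rw [e] at h1 h2 <;> omega

theorem nonempty_iso (h : IsSRSG A a (-2)) (hV : Fintype.card V = 9) :
    Nonempty ((SimpleGraph.fromRel (fun i j => A i j ≠ 0)) ≃g
      SimpleGraph.completeMultipartiteGraph (fun _ : Fin 3 => Fin 3)) := by
  classical
  let r : Setoid V :=
    { r := fun x y => A x y = 0
      iseqv := by
        refine ⟨h.diag, fun {x y} e => h.symm x y ▸ e, fun {x y z} e e' => ?_⟩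
        by_cases hxz : x = z
        · rw [hxz, h.diag]
        by_cases hxy : x = y
        · rwa [hxy]
        by_cases hyz : y = z
        · rwa [← hyz]
        exact h.nonadj_trans hV (Ne.symm hxy) hyz hxz (h.symm x y ▸ e) e' }
  have hr : ∀ x, (Finset.univ.filter (fun y => r x y)).card = 3 := by
    intro x
    have e1 := h.sum_abs x
    have e2 : ∀ y, |A x y| = 1 - if A x y = 0 then 1 else 0 := by
      intro y
      rcases h.ent x y with e | e | e <;> simp [e]
    simp only [e2, Finset.sum_sub_distrib, ← Finset.sum_filter, Finset.sum_const,
      Finset.card_univ, hV, nsmul_eq_mul, mul_one] at e1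
    have e3 : Finset.univ.filter (fun y => r x y) = Finset.univ.filter (fun y => A x y = 0) := by
      ext y
      simp only [Finset.mem_filter, Finset.mem_univ, true_and]
      rfl
    rw [e3]
    omega
  obtain ⟨k, e, he⟩ := exists_equiv_sigma r hr
  obtain rfl : k = 3 := by
    have := Fintype.card_congr e
    simp [hV] at this
    omega
  refine ⟨⟨e, fun {x y} => ?_⟩⟩
  have hxy : A x y = 0 ↔ (e x).1 = (e y).1 := he x y
  simp only [SimpleGraph.fromRel_adj, SimpleGraph.completeMultipartiteGraph, SimpleGraph.comap_adj,
    SimpleGraph.top_adj, ne_eq, ← hxy, h.symm y x, or_self]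
  constructor
  · intro e'
    refine ⟨?_, e'⟩
    rintro rfl
    exact e' (h.diag x)
  · exact fun e' => e'.2

end IsSRSG

theorem stmt11 {n : ℕ} (A : Matrix (Fin n) (Fin n) ℤ) (a b c : ℤ)
    (hsymm : ∀ i j, A i j = A j i)
    (hdiag : ∀ i, A i i = 0)
    (hent : ∀ i j, A i j = -1 ∨ A i j = 0 ∨ A i j = 1)
    (hconn : (SimpleGraph.fromRel (fun i j => A i j ≠ 0)).Connected)
    (hncomp : ¬ ∀ i j : Fin n, i ≠ j → A i j ≠ 0)
    (hinhom : (∃ i j, A i j = 1) ∧ (∃ i j, A i j = -1))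
    (hreg : ∀ i, (Finset.univ.filter (fun j => A i j ≠ 0)).card = 6)
    (hnet : ∀ i, ∑ j, A i j = 2)
    (hAA : ∀ i, (A * A) i i = 6)
    (hpos : ∀ i j, A i j = 1 → (A * A) i j = a)
    (hneg : ∀ i j, A i j = -1 → (A * A) i j = b)
    (hnon : ∀ i j, i ≠ j → A i j = 0 → (A * A) i j = c)
    (hclass : ¬(a = -b ∧ c = 0) ∧ ¬(a ≠ -b ∧ 2 * c = a + b))
    (htri1 : ∃ i j k : Fin n,
      (A i j = -1 ∧ A j k = 1 ∧ A i k = 1) ∨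
      (A i j = 1 ∧ A j k = -1 ∧ A i k = 1) ∨
      (A i j = 1 ∧ A j k = 1 ∧ A i k = -1)) :
    ¬(a = -2 ∧ b = 3) ∧
    ((a = -1 ∧ b = 3) → n = 9 ∧ c = -2 ∧
      Nonempty ((SimpleGraph.fromRel (fun i j => A i j ≠ 0)) ≃g
        SimpleGraph.completeMultipartiteGraph (fun _ : Fin 3 => Fin 3))) := by
  have hsrsg (ha : -2 ≤ a) (hb : b = 3) : IsSRSG A a c := by
    subst hb
    have hcard : ∀ i, (Finset.univ.filter (fun j => A i j = 1)).card = 4 ∧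
        (Finset.univ.filter (fun j => A i j = -1)).card = 2 := by
      intro i
      have e1 := hnet i
      have e2 := hreg i
      rw [Finset.card_filter] at e2
      zify at e2
      have k1 : ∀ j, A i j = (if A i j = 1 then 1 else 0) - (if A i j = -1 then 1 else 0) := by
        intro j
        rcases hent i j with e | e | e <;> simp [e]
      have k2 : ∀ j, (if A i j ≠ 0 then 1 else 0 : ℤ) =
          (if A i j = 1 then 1 else 0) + (if A i j = -1 then 1 else 0) := by
        intro j
        rcases hent i j with e | e | e <;> simp [e]
      rw [Finset.sum_congr rfl fun j _ => k1 j, Finset.sum_sub_distrib] at e1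
      rw [Finset.sum_congr rfl fun j _ => k2 j, Finset.sum_add_distrib] at e2
      simp only [Finset.sum_boole] at e1 e2
      constructor <;> grind
    refine ⟨hsymm, hdiag, hent, fun i => (hcard i).1, fun i => (hcard i).2, ?_, ?_, ?_, ha, ?_⟩
    · simpa only [Matrix.mul_apply] using hpos
    · simpa only [Matrix.mul_apply] using hneg
    · simpa only [Matrix.mul_apply] using hnon
    · push Not at hncomp
      obtain ⟨i, j, hij, e⟩ := hncomp
      have hsub : Finset.univ.filter (fun k => A i k ≠ 0) ⊆ (Finset.univ.erase i).erase j := by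
        intro k hk
        simp only [Finset.mem_filter, Finset.mem_univ, true_and] at hk
        simp only [Finset.mem_erase, Finset.mem_univ, and_true]
        constructor <;> rintro rfl
        · exact hk e
        · exact hk (hdiag k)
      have hle := Finset.card_le_card hsub
      rw [hreg, Finset.card_erase_of_mem (by simp [hij.symm]),
        Finset.card_erase_of_mem (by simp), Finset.card_univ] at hle
      omega
  constructor
  · rintro ⟨rfl, hb⟩
    have h := hsrsg le_rfl hb
    have h1 := h.mul_card_sub_seven
    have h2 := h.seven_lt
    have h3 : (Fintype.card (Fin n) : ℤ) - 7 ≠ 0 := by omega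
    obtain rfl : c = 0 := (mul_eq_zero.1 (h1.trans (by norm_num))).resolve_right h3
    exact h.ne_neg_two rfl
  · rintro ⟨rfl, hb⟩
    have h := hsrsg (by norm_num) hb
    obtain ⟨h1, rfl⟩ := h.card_eq_nine
    exact ⟨by simpa using h1, rfl, h.nonempty_iso h1⟩
end

section
/- Let A be the adjacency matrix of a connected, non-complete, inhomogeneous, 6-regular and 2 net-regular strongly regular signed graph with parameters (n, 6, a, b, c) lying in the class C1 ∪ C4 ∪ C5. If A contains an unbalanced triangle of the second type, then either (b = 1 and 0 ≤ a ≤ 3) or (b = 3 and (a = -1 or a = -2)). -/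
/-- Positive and negative neighbourhoods of a signed graph with four positive and two negative
neighbours at each vertex, whose positive and negative adjacency matrices commute and whose signed
count of walks of length two is `a` on positive edges and `b` on negative edges. -/
structure SignedNeighborhoods {V : Type*} [DecidableEq V] (P N : V → Finset V) (a b : ℤ) :
    Prop where
  pos_symm : ∀ {i j}, j ∈ P i → i ∈ P j
  neg_symm : ∀ {i j}, j ∈ N i → i ∈ N j
  not_both : ∀ {i j}, j ∈ P i → j ∉ N i
  pos_irrefl : ∀ i, i ∉ P i
  neg_irrefl : ∀ i, i ∉ N i
  card_pos : ∀ i, (P i).card = 4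
  card_neg : ∀ i, (N i).card = 2
  comm : ∀ i j, (P i ∩ N j).card = (N i ∩ P j).card
  pos_walks : ∀ i j, j ∈ P i →
    ((P i ∩ P j).card : ℤ) + (N i ∩ N j).card - 2 * (P i ∩ N j).card = a
  neg_walks : ∀ i j, j ∈ N i →
    ((P i ∩ P j).card : ℤ) + (N i ∩ N j).card - 2 * (P i ∩ N j).card = b

namespace SignedNeighborhoods

variable {V : Type*} [DecidableEq V] {P N : V → Finset V} {a b : ℤ}

lemma neg_eq_pair (h : SignedNeighborhoods P N a b) {t u v : V}
    (hu : u ∈ N t) (hv : v ∈ N t) (huv : u ≠ v) : N t = {u, v} := by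
  symm
  apply Finset.eq_of_subset_of_card_le
  · intro x hx
    simp only [Finset.mem_insert, Finset.mem_singleton] at hx
    rcases hx with rfl | rfl <;> assumption
  · rw [h.card_neg, Finset.card_pair huv]

/-- On an all-negative triangle `b` counts the common positive neighbours of an edge plus one. -/
lemma card_common_pos (h : SignedNeighborhoods P N a b) {t u v : V}
    (hu : u ∈ N t) (hv : v ∈ N t) (huv : v ∈ N u) : ((P t ∩ P u).card : ℤ) = b - 1 := by
  have hne : u ≠ v := fun e => h.neg_irrefl u (e ▸ huv)
  have htv : t ≠ v := fun e => h.neg_irrefl v (e ▸ hv)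
  have htu : t ≠ u := fun e => h.neg_irrefl u (e ▸ hu)
  have hNt := h.neg_eq_pair hu hv hne
  have hNu := h.neg_eq_pair (h.neg_symm hu) huv htv
  have hNN : N t ∩ N u = {v} := by
    rw [hNt, hNu]
    ext x
    simp only [Finset.mem_inter, Finset.mem_insert, Finset.mem_singleton]
    grind
  have hPN : P t ∩ N u = ∅ := by
    rw [hNu]
    ext x
    simp only [Finset.mem_inter, Finset.mem_insert, Finset.mem_singleton, Finset.notMem_empty,
      iff_false]
    rintro ⟨hx, rfl | rfl⟩
    · exact h.pos_irrefl _ hx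
    · exact h.not_both hx hv
  have := h.neg_walks t u hu
  rw [hNN, hPN] at this
  simp at this
  linarith

/-- The negative edges from a positive neighbour `w` of `t` back into `P t` are counted by the
other two vertices of the negative triangle. -/
lemma card_pos_inter_neg (h : SignedNeighborhoods P N a b) {t u v w : V}
    (hu : u ∈ N t) (hv : v ∈ N t) (huv : v ∈ N u) :
    (P t ∩ N w).card = (if w ∈ P u then 1 else 0) + (if w ∈ P v then 1 else 0) := by
  have hne : u ≠ v := fun e => h.neg_irrefl u (e ▸ huv)
  rw [h.comm, h.neg_eq_pair hu hv hne, ← Finset.filter_mem_eq_inter, Finset.card_filter,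
    Finset.sum_pair hne]
  have key : ∀ x, x ∈ P w ↔ w ∈ P x := fun x => ⟨h.pos_symm, h.pos_symm⟩
  simp only [key]

lemma sum_card_pos_inter_neg (h : SignedNeighborhoods P N a b) {t u v : V}
    (hu : u ∈ N t) (hv : v ∈ N t) (huv : v ∈ N u) :
    ((∑ w ∈ P t, (P t ∩ N w).card : ℕ) : ℤ) = 2 * (b - 1) := by
  have e1 := h.card_common_pos hu hv huv
  have e2 := h.card_common_pos hv hu (h.neg_symm huv)
  have : ∑ w ∈ P t, (P t ∩ N w).card = (P t ∩ P u).card + (P t ∩ P v).card := by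
    rw [Finset.sum_congr rfl fun w _ => h.card_pos_inter_neg hu hv huv, Finset.sum_add_distrib,
      ← Finset.card_filter, ← Finset.card_filter, Finset.filter_mem_eq_inter,
      Finset.filter_mem_eq_inter]
  rw [this]
  push_cast
  linarith

lemma pos_walks_of_triangle (h : SignedNeighborhoods P N a b) {t u v w : V}
    (hu : u ∈ N t) (hv : v ∈ N t) (huv : v ∈ N u) (hw : w ∈ P t) :
    ((P t ∩ P w).card : ℤ) - 2 * (P t ∩ N w).card = a := by
  have hne : u ≠ v := fun e => h.neg_irrefl u (e ▸ huv)
  have htv : t ≠ v := fun e => h.neg_irrefl v (e ▸ hv)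
  have htu : t ≠ u := fun e => h.neg_irrefl u (e ▸ hu)
  have hNu := h.neg_eq_pair (h.neg_symm hu) huv htv
  have hNv := h.neg_eq_pair (h.neg_symm hv) (h.neg_symm huv) htu
  have hNt := h.neg_eq_pair hu hv hne
  have hNN : N t ∩ N w = ∅ := by
    have hwt : w ≠ t := fun e => h.pos_irrefl t (e ▸ hw)
    have hwN := h.not_both hw
    ext x
    simp only [Finset.mem_inter, Finset.notMem_empty, iff_false]
    rintro ⟨hx, hxw⟩
    have hwx := h.neg_symm hxw
    rw [hNt] at hx hwN
    simp only [Finset.mem_insert, Finset.mem_singleton] at hx hwN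
    rcases hx with rfl | rfl
    · rw [hNu] at hwx
      simp only [Finset.mem_insert, Finset.mem_singleton] at hwx
      tauto
    · rw [hNv] at hwx
      simp only [Finset.mem_insert, Finset.mem_singleton] at hwx
      tauto
  have := h.pos_walks t w hw
  rw [hNN] at this
  simpa using this

lemma inter_pos_union_inter_neg_subset (h : SignedNeighborhoods P N a b) (s : Finset V) (w : V) :
    s ∩ P w ∪ s ∩ N w ⊆ s.erase w := by
  intro x hx
  simp only [Finset.mem_union, Finset.mem_inter, Finset.mem_erase] at hx ⊢
  rcases hx with hx | hx
  · exact ⟨fun e => h.pos_irrefl w (e ▸ hx.2), hx.1⟩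
  · exact ⟨fun e => h.neg_irrefl w (e ▸ hx.2), hx.1⟩

lemma card_inter_pos_union_inter_neg (h : SignedNeighborhoods P N a b) (s : Finset V) (w : V) :
    (s ∩ P w ∪ s ∩ N w).card = (s ∩ P w).card + (s ∩ N w).card := by
  apply Finset.card_union_of_disjoint
  rw [Finset.disjoint_left]
  intro x hx hx'
  exact h.not_both (Finset.mem_inter.1 hx).2 (Finset.mem_inter.1 hx').2

lemma card_inter_pos_add_card_inter_neg_le (h : SignedNeighborhoods P N a b) {t w : V}
    (hw : w ∈ P t) : (P t ∩ P w).card + (P t ∩ N w).card ≤ 3 := by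
  rw [← h.card_inter_pos_union_inter_neg]
  refine (Finset.card_le_card (h.inter_pos_union_inter_neg_subset _ _)).trans ?_
  rw [Finset.card_erase_of_mem hw, h.card_pos]

lemma adj_of_card_eq (h : SignedNeighborhoods P N a b) {t w x : V} (hw : w ∈ P t) (hx : x ∈ P t)
    (hxw : x ≠ w) (hc : (P t ∩ P w).card + (P t ∩ N w).card = 3) : x ∈ P w ∨ x ∈ N w := by
  have he : P t ∩ P w ∪ P t ∩ N w = (P t).erase w := by
    apply Finset.eq_of_subset_of_card_le (h.inter_pos_union_inter_neg_subset _ _)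
    rw [h.card_inter_pos_union_inter_neg, hc, Finset.card_erase_of_mem hw, h.card_pos]
  have : x ∈ (P t).erase w := Finset.mem_erase.2 ⟨hxw, hx⟩
  rw [← he] at this
  simp only [Finset.mem_union, Finset.mem_inter] at this
  tauto

/-- The number of negative edges back into `P t` is the same at every positive neighbour of a
vertex `t` of an all-negative triangle. -/
lemma card_pos_inter_neg_eq (h : SignedNeighborhoods P N a b) {t u v w y : V}
    (hu : u ∈ N t) (hv : v ∈ N t) (huv : v ∈ N u) (hw : w ∈ P t) (hy : y ∈ P t) :
    (P t ∩ N y).card = (P t ∩ N w).card := by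
  have hle : ∀ {w y}, w ∈ P t → y ∈ P t → (P t ∩ N w).card ≤ (P t ∩ N y).card := by
    intro w y hw hy
    have hw1 := h.pos_walks_of_triangle hu hv huv hw
    have hy1 := h.pos_walks_of_triangle hu hv huv hy
    have hw2 := h.card_inter_pos_add_card_inter_neg_le hw
    have hw3 : (P t ∩ N w).card ≤ 2 :=
      (Finset.card_le_card Finset.inter_subset_right).trans (h.card_neg w).le
    by_contra! hlt
    have hw4 : (P t ∩ N w).card = 1 := by omega
    have hxy : w ≠ y := by rintro rfl; omega
    rcases h.adj_of_card_eq hw hy hxy.symm (by omega) with hadj | hadj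
    · have : 0 < (P t ∩ P y).card :=
        Finset.card_pos.2 ⟨w, Finset.mem_inter.2 ⟨hw, h.pos_symm hadj⟩⟩
      omega
    · have : 0 < (P t ∩ N y).card :=
        Finset.card_pos.2 ⟨w, Finset.mem_inter.2 ⟨hw, h.neg_symm hadj⟩⟩
      omega
  exact le_antisymm (hle hy hw) (hle hw hy)

lemma two_mul_card_pos_inter_neg (h : SignedNeighborhoods P N a b) {t u v w : V}
    (hu : u ∈ N t) (hv : v ∈ N t) (huv : v ∈ N u) (hw : w ∈ P t) :
    2 * ((P t ∩ N w).card : ℤ) = b - 1 := by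
  have e := h.sum_card_pos_inter_neg hu hv huv
  rw [Finset.sum_congr rfl fun y hy => h.card_pos_inter_neg_eq hu hv huv hw hy,
    Finset.sum_const, h.card_pos] at e
  simp only [smul_eq_mul] at e
  push_cast at e
  linarith

lemma ne_five (h : SignedNeighborhoods P N a b) {t u v : V}
    (hu : u ∈ N t) (hv : v ∈ N t) (huv : v ∈ N u) : b ≠ 5 := by
  rintro rfl
  have hsub : ∀ w ∈ P t, N w ⊆ P t := by
    intro w hw
    have hc := h.two_mul_card_pos_inter_neg hu hv huv hw
    have he : P t ∩ N w = N w := by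
      apply Finset.eq_of_subset_of_card_le Finset.inter_subset_right
      rw [h.card_neg]
      omega
    exact Finset.inter_eq_right.1 he
  have htriangle : ∀ w x, x ∈ N w → ∃ y, y ∈ N w ∧ y ∈ N x := by
    intro w x hx
    have hb := h.neg_walks w x hx
    have hle : (P w ∩ P x).card ≤ 4 :=
      (Finset.card_le_card Finset.inter_subset_left).trans (h.card_pos w).le
    have hpos : 0 < (N w ∩ N x).card := by omega
    obtain ⟨y, hy⟩ := Finset.card_pos.1 hpos
    exact ⟨y, Finset.mem_inter.1 hy⟩
  obtain ⟨w, hw⟩ : (P t).Nonempty := Finset.card_pos.1 (by rw [h.card_pos]; norm_num)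
  obtain ⟨x, hx⟩ : (N w).Nonempty := Finset.card_pos.1 (by rw [h.card_neg]; norm_num)
  obtain ⟨y, hyw, hyx⟩ := htriangle w x hx
  have hxy : x ≠ y := fun e => h.neg_irrefl x (e ▸ hyx)
  have hwy : w ≠ y := fun e => h.neg_irrefl y (e ▸ hyw)
  have hwx : w ≠ x := fun e => h.neg_irrefl x (e ▸ hx)
  have hNw := h.neg_eq_pair hx hyw hxy
  have hNx := h.neg_eq_pair (h.neg_symm hx) hyx hwy
  have hNy := h.neg_eq_pair (h.neg_symm hyw) (h.neg_symm hyx) hwx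
  have hxP := hsub w hw hx
  have hyP := hsub w hw hyw
  have hcard : ({w, x, y} : Finset V).card = 3 := by
    rw [Finset.card_eq_three]
    exact ⟨w, x, y, hwx, hwy, hxy, rfl⟩
  obtain ⟨s, hs, hsn⟩ : ∃ s ∈ P t, s ∉ ({w, x, y} : Finset V) :=
    Finset.exists_mem_notMem_of_card_lt_card (by rw [hcard, h.card_pos]; norm_num)
  have hP : P t = insert s {w, x, y} := by
    symm
    apply Finset.eq_of_subset_of_card_le
    · intro z hz
      simp only [Finset.mem_insert, Finset.mem_singleton] at hz
      rcases hz with rfl | rfl | rfl | rfl <;> assumption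
    · rw [Finset.card_insert_of_notMem hsn, hcard, h.card_pos]
  obtain ⟨z, hz⟩ : (N s).Nonempty := Finset.card_pos.1 (by rw [h.card_neg]; norm_num)
  have hzP := hsub s hs hz
  have hsz := h.neg_symm hz
  have hzs : z ≠ s := fun e => h.neg_irrefl s (e ▸ hz)
  rw [hP] at hzP
  simp only [Finset.mem_insert, Finset.mem_singleton] at hzP hsn
  rcases hzP with rfl | rfl | rfl | rfl
  · exact hzs rfl
  all_goals simp_all

lemma ne_zero_of_eq_three (h : SignedNeighborhoods P N a b) {t u v : V}
    (hu : u ∈ N t) (hv : v ∈ N t) (huv : v ∈ N u) (hb : b = 3) : a ≠ 0 := by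
  intro ha
  have hadj : ∀ {t u v}, u ∈ N t → v ∈ N t → v ∈ N u → ∀ {w x}, w ∈ P t → x ∈ P t → x ≠ w →
      x ∈ P w ∨ x ∈ N w := by
    intro t u v hu hv huv w x hw hx hxw
    have e1 := h.two_mul_card_pos_inter_neg hu hv huv hw
    have e2 := h.pos_walks_of_triangle hu hv huv hw
    exact h.adj_of_card_eq hw hx hxw (by omega)
  have hcommon := h.card_common_pos hu hv huv
  have hunion := Finset.card_union_add_card_inter (P t) (P u)
  rw [h.card_pos, h.card_pos] at hunion
  obtain ⟨w, hw⟩ : (P t ∩ P u).Nonempty := Finset.card_pos.1 (by omega)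
  obtain ⟨hwt, hwu⟩ := Finset.mem_inter.1 hw
  have htu : t ≠ u := fun e => h.neg_irrefl u (e ▸ hu)
  have hut := h.neg_symm hu
  have htn : t ∉ P t ∪ P u := by
    rw [Finset.mem_union]
    rintro (hh | hh)
    · exact h.pos_irrefl t hh
    · exact h.not_both hh hut
  have hun : u ∉ P t ∪ P u := by
    rw [Finset.mem_union]
    rintro (hh | hh)
    · exact h.not_both hh hu
    · exact h.pos_irrefl u hh
  have hsub : insert t (insert u ((P t ∪ P u).erase w)) ⊆ P w ∪ N w := by
    intro x hx
    simp only [Finset.mem_insert, Finset.mem_erase, Finset.mem_union] at hx ⊢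
    rcases hx with rfl | rfl | ⟨hxw, hx | hx⟩
    · exact Or.inl (h.pos_symm hwt)
    · exact Or.inl (h.pos_symm hwu)
    · exact hadj hu hv huv hwt hx hxw
    · exact hadj hut huv hv hwu hx hxw
  have hle := (Finset.card_le_card hsub).trans (Finset.card_union_le _ _)
  rw [Finset.card_insert_of_notMem, Finset.card_insert_of_notMem,
    Finset.card_erase_of_mem (Finset.mem_union_left _ hwt), h.card_pos, h.card_neg] at hle
  · omega
  · exact fun hh => hun (Finset.mem_of_mem_erase hh)
  · rw [Finset.mem_insert]
    rintro (hh | hh)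
    · exact htu hh
    · exact htn (Finset.mem_of_mem_erase hh)

/-- The possible parameters in the presence of an all-negative triangle. -/
theorem parameters_of_triangle (h : SignedNeighborhoods P N a b) {t u v : V}
    (hu : u ∈ N t) (hv : v ∈ N t) (huv : v ∈ N u) :
    (b = 1 ∧ 0 ≤ a ∧ a ≤ 3) ∨ (b = 3 ∧ (a = -1 ∨ a = -2)) := by
  obtain ⟨w, hw⟩ : (P t).Nonempty := Finset.card_pos.1 (by rw [h.card_pos]; norm_num)
  have e1 := h.two_mul_card_pos_inter_neg hu hv huv hw
  have e2 := h.pos_walks_of_triangle hu hv huv hw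
  have e3 := h.card_inter_pos_add_card_inter_neg_le hw
  have e4 : (P t ∩ N w).card ≤ 2 :=
    (Finset.card_le_card Finset.inter_subset_right).trans (h.card_neg w).le
  have e5 := h.ne_five hu hv huv
  have e6 := h.ne_zero_of_eq_three hu hv huv
  omega

end SignedNeighborhoods

section SignedMatrix

variable {n : ℕ} {A : Matrix (Fin n) (Fin n) ℤ}

/-- An entry of `A * A` counts common neighbours, with the sign of the corresponding walk. -/
lemma mul_self_apply_eq_card (hsymm : ∀ i j, A i j = A j i)
    (hent : ∀ i j, A i j = -1 ∨ A i j = 0 ∨ A i j = 1) (i j : Fin n) :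
    (A * A) i j =
      ((Finset.univ.filter (A i · = 1) ∩ Finset.univ.filter (A j · = 1)).card : ℤ)
      + (Finset.univ.filter (A i · = -1) ∩ Finset.univ.filter (A j · = -1)).card
      - (Finset.univ.filter (A i · = 1) ∩ Finset.univ.filter (A j · = -1)).card
      - (Finset.univ.filter (A i · = -1) ∩ Finset.univ.filter (A j · = 1)).card := by
  simp only [← Finset.filter_and, Finset.card_filter, Matrix.mul_apply]
  push_cast
  rw [← Finset.sum_add_distrib, ← Finset.sum_sub_distrib, ← Finset.sum_sub_distrib]
  refine Finset.sum_congr rfl fun k _ => ?_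
  rw [hsymm k j]
  rcases hent i k with hx | hx | hx <;> rcases hent j k with hy | hy | hy <;> simp [hx, hy]

/-- If the support matrix of a signed graph is a combination of `1`, the all-ones matrix, `A` and
`A * A`, then its positive and negative parts commute. -/
lemma card_pos_inter_neg_comm {a b c r ρ : ℤ} (hsymm : ∀ i j, A i j = A j i)
    (hdiag : ∀ i, A i i = 0) (hent : ∀ i j, A i j = -1 ∨ A i j = 0 ∨ A i j = 1)
    (hnet : ∀ i, ∑ j, A i j = ρ) (hAA : ∀ i, (A * A) i i = r)
    (hpos : ∀ i j, A i j = 1 → (A * A) i j = a)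
    (hneg : ∀ i j, A i j = -1 → (A * A) i j = b)
    (hnon : ∀ i j, i ≠ j → A i j = 0 → (A * A) i j = c) (hc : 2 * c ≠ a + b) (i j : Fin n) :
    (Finset.univ.filter (A i · = 1) ∩ Finset.univ.filter (A j · = -1)).card =
      (Finset.univ.filter (A i · = -1) ∩ Finset.univ.filter (A j · = 1)).card := by
  have hsq : ∀ x y, 2 * (A * A) x y = (a + b - 2 * c) * A x y ^ 2 + (a - b) * A x y
      + (2 * r - 2 * c) * (1 : Matrix (Fin n) (Fin n) ℤ) x y + 2 * c := by
    intro x y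
    rcases eq_or_ne x y with rfl | hxy
    · rw [hAA, hdiag, Matrix.one_apply_eq]
      ring
    · rw [Matrix.one_apply_ne hxy]
      rcases hent x y with hv | hv | hv
      · rw [hneg _ _ hv, hv]; ring
      · rw [hnon _ _ hxy hv, hv]; ring
      · rw [hpos _ _ hv, hv]; ring
  have hl : 2 * (A * (A * A)) i j = (a + b - 2 * c) * ∑ k, A i k * A k j ^ 2
      + (a - b) * (A * A) i j + (2 * r - 2 * c) * A i j + 2 * c * ρ := by
    conv_rhs => rw [← hnet i, Matrix.mul_apply, ← Matrix.mul_one A]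
    rw [Matrix.mul_apply, Matrix.mul_apply (M := A) (N := 1), Matrix.mul_one]
    simp only [Finset.mul_sum, ← Finset.sum_add_distrib]
    refine Finset.sum_congr rfl fun k _ => ?_
    linear_combination A i k * hsq k j
  have hr : 2 * ((A * A) * A) i j = (a + b - 2 * c) * ∑ k, A i k ^ 2 * A k j
      + (a - b) * (A * A) i j + (2 * r - 2 * c) * A i j + 2 * c * ρ := by
    conv_rhs => rw [← hnet j, Matrix.mul_apply, ← Matrix.one_mul A]
    rw [Matrix.mul_apply, Matrix.mul_apply (M := 1) (N := A), Matrix.one_mul]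
    simp only [Finset.mul_sum, ← Finset.sum_add_distrib]
    refine Finset.sum_congr rfl fun k _ => ?_
    rw [hsymm j k]
    linear_combination A k j * hsq i k
  have hsum : ∑ k, A i k * A k j ^ 2 = ∑ k, A i k ^ 2 * A k j := by
    rw [Matrix.mul_assoc] at hr
    exact mul_left_cancel₀ (sub_ne_zero.2 hc.symm) (by linarith)
  have hdiff : ∑ k, (A i k * A k j ^ 2 - A i k ^ 2 * A k j) = 0 := by
    rw [Finset.sum_sub_distrib, hsum, sub_self]
  have hcards : ∑ k, (A i k * A k j ^ 2 - A i k ^ 2 * A k j) =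
      2 * ((Finset.univ.filter (A i · = 1) ∩ Finset.univ.filter (A j · = -1)).card : ℤ)
      - 2 * (Finset.univ.filter (A i · = -1) ∩ Finset.univ.filter (A j · = 1)).card := by
    simp only [← Finset.filter_and, Finset.card_filter]
    push_cast
    rw [Finset.mul_sum, Finset.mul_sum, ← Finset.sum_sub_distrib]
    refine Finset.sum_congr rfl fun k _ => ?_
    rw [hsymm k j]
    rcases hent i k with hx | hx | hx <;> rcases hent j k with hy | hy | hy <;> simp [hx, hy]
  omega

lemma card_pos_and_card_neg {i : Fin n} (hent : ∀ j, A i j = -1 ∨ A i j = 0 ∨ A i j = 1)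
    (hreg : (Finset.univ.filter (fun j => A i j ≠ 0)).card = 6) (hnet : ∑ j, A i j = 2) :
    (Finset.univ.filter (A i · = 1)).card = 4 ∧ (Finset.univ.filter (A i · = -1)).card = 2 := by
  have e1 : ((Finset.univ.filter (A i · = 1)).card : ℤ) - (Finset.univ.filter (A i · = -1)).card
      = 2 := by
    rw [← hnet, Finset.card_filter, Finset.card_filter]
    push_cast
    rw [← Finset.sum_sub_distrib]
    refine Finset.sum_congr rfl fun k _ => ?_
    rcases hent k with hx | hx | hx <;> simp [hx]
  have e2 : (Finset.univ.filter (A i · = 1)).card + (Finset.univ.filter (A i · = -1)).card = 6 := by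
    rw [← hreg, Finset.card_filter, Finset.card_filter, Finset.card_filter,
      ← Finset.sum_add_distrib]
    refine Finset.sum_congr rfl fun k _ => ?_
    rcases hent k with hx | hx | hx <;> simp [hx]
  omega

end SignedMatrix

theorem stmt12 {n : ℕ} (A : Matrix (Fin n) (Fin n) ℤ) (a b c : ℤ)
    (hsymm : ∀ i j, A i j = A j i)
    (hdiag : ∀ i, A i i = 0)
    (hent : ∀ i j, A i j = -1 ∨ A i j = 0 ∨ A i j = 1)
    (hconn : (SimpleGraph.fromRel (fun i j => A i j ≠ 0)).Connected)
    (hncomp : ¬ ∀ i j : Fin n, i ≠ j → A i j ≠ 0)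
    (hinhom : (∃ i j, A i j = 1) ∧ (∃ i j, A i j = -1))
    (hreg : ∀ i, (Finset.univ.filter (fun j => A i j ≠ 0)).card = 6)
    (hnet : ∀ i, ∑ j, A i j = 2)
    (hAA : ∀ i, (A * A) i i = 6)
    (hpos : ∀ i j, A i j = 1 → (A * A) i j = a)
    (hneg : ∀ i j, A i j = -1 → (A * A) i j = b)
    (hnon : ∀ i j, i ≠ j → A i j = 0 → (A * A) i j = c)
    (hclass : ¬(a = -b ∧ c = 0) ∧ ¬(a ≠ -b ∧ 2 * c = a + b))
    (htri2 : ∃ i j k : Fin n, A i j = -1 ∧ A j k = -1 ∧ A i k = -1) :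
    (b = 1 ∧ 0 ≤ a ∧ a ≤ 3) ∨ (b = 3 ∧ (a = -1 ∨ a = -2)) := by
  have hc : 2 * c ≠ a + b := by
    intro he
    by_cases hab : a = -b
    · exact hclass.1 ⟨hab, by omega⟩
    · exact hclass.2 ⟨hab, he⟩
  have hcomm := card_pos_inter_neg_comm hsymm hdiag hent hnet hAA hpos hneg hnon hc
  have h : SignedNeighborhoods (fun i => Finset.univ.filter (A i · = 1))
      (fun i => Finset.univ.filter (A i · = -1)) a b :=
    { pos_symm := fun {i j} hij => by simpa [hsymm j i] using hij
      neg_symm := fun {i j} hij => by simpa [hsymm j i] using hij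
      not_both := fun {i j} hij => by
        have : A i j = 1 := by simpa using hij
        simp [this]
      pos_irrefl := fun i => by simp [hdiag]
      neg_irrefl := fun i => by simp [hdiag]
      card_pos := fun i => (card_pos_and_card_neg (hent i) (hreg i) (hnet i)).1
      card_neg := fun i => (card_pos_and_card_neg (hent i) (hreg i) (hnet i)).2
      comm := hcomm
      pos_walks := fun i j hij => by
        rw [← hpos i j (by simpa using hij), mul_self_apply_eq_card hsymm hent, ← hcomm]
        ring
      neg_walks := fun i j hij => by
        rw [← hneg i j (by simpa using hij), mul_self_apply_eq_card hsymm hent, ← hcomm]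
        ring }
  obtain ⟨i, j, k, hij, hjk, hik⟩ := htri2
  exact h.parameters_of_triangle (t := i) (u := j) (v := k) (by simpa using hij)
    (by simpa using hik) (by simpa using hjk)
end

section
/- Let A be the adjacency matrix of a connected, non-complete, inhomogeneous, 6-regular and 2 net-regular strongly regular signed graph with parameters (n, 6, a, b, c) lying in the class C1 ∪ C4 ∪ C5. If (a, b) = (1, 1), then n = 15, c = -1, and the underlying simple graph of A (with adjacency relation A i j ≠ 0) is strongly regular with parameters (15, 6, 1, 3): any two adjacent vertices have exactly 1 common neighbour and any two distinct non-adjacent vertices have exactly 3 common neighbours. -/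
open Finset in
/-- A sum of nonnegative integers dominates the sum of two of its terms. -/
theorem add_le_sum_of_nonneg {n : ℕ} (f : Fin n → ℤ) (hf : ∀ k, 0 ≤ f k) {i j : Fin n}
    (hij : i ≠ j) : f i + f j ≤ ∑ k, f k := by
  rw [← sum_pair hij]
  exact sum_le_sum_of_subset_of_nonneg (subset_univ _) fun k _ _ => hf k

/-- The positive and negative parts of a symmetric matrix commute if the matrix commutes with
its entrywise absolute value. -/
theorem commute_parts {n : ℕ} {A B P N : Matrix (Fin n) (Fin n) ℤ} (hA : A = P - N)
    (hB : B = P + N) (h : A * B = B * A) : P * N = N * P := by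
  have h2 : (2 : ℤ) • (P * N) = (2 : ℤ) • (N * P) := by
    rw [hA, hB] at h
    have h' : (P - N) * (P + N) - (P + N) * (P - N) = 0 := sub_eq_zero.mpr h
    have e : (P - N) * (P + N) - (P + N) * (P - N) = (2 : ℤ) • (P * N) - (2 : ℤ) • (N * P) := by
      noncomm_ring
    exact sub_eq_zero.mp (e ▸ h')
  exact smul_right_injective _ two_ne_zero h2

/-- An integer matrix with constant row and column sums commutes with every matrix `B` such that
`d • B`, with `d ≠ 0`, is a combination of its square, the identity and the all-ones matrix. -/
theorem commute_of_sq_eq {n : ℕ} {A B : Matrix (Fin n) (Fin n) ℤ} {s d x y : ℤ}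
    (hrow : ∀ i, ∑ j, A i j = s) (hcol : ∀ j, ∑ i, A i j = s) (hd : d ≠ 0)
    (h : A * A = d • B + x • (1 : Matrix (Fin n) (Fin n) ℤ) + y • Matrix.of fun _ _ => 1) :
    A * B = B * A := by
  have hJ : A * (Matrix.of fun _ _ => (1 : ℤ)) = (Matrix.of fun _ _ => (1 : ℤ)) * A := by
    ext i j
    simp [Matrix.mul_apply, hrow, hcol]
  have e : d • B = A * A - x • (1 : Matrix (Fin n) (Fin n) ℤ) - y • Matrix.of fun _ _ => 1 := by
    rw [h]; abel
  have h2 : d • (A * B) = d • (B * A) := by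
    rw [← Matrix.mul_smul, ← Matrix.smul_mul, e]
    simp only [Matrix.mul_sub, Matrix.sub_mul, Matrix.mul_smul, Matrix.smul_mul, hJ,
      Matrix.mul_one, Matrix.one_mul, Matrix.mul_assoc]
  exact smul_right_injective _ hd h2

/-- The row sums of a product are the products of the row sums. -/
theorem sum_mul_apply_of_row_sums {n : ℕ} {X Y : Matrix (Fin n) (Fin n) ℤ} {s t : ℤ}
    (hX : ∀ i, ∑ j, X i j = s) (hY : ∀ i, ∑ j, Y i j = t) (i : Fin n) :
    ∑ j, (X * Y) i j = s * t := by
  simp only [Matrix.mul_apply]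
  rw [Finset.sum_comm]
  simp only [← Finset.mul_sum, hY, ← Finset.sum_mul, hX]

theorem mul_apply_nonneg {n : ℕ} {X Y : Matrix (Fin n) (Fin n) ℤ} (hX : ∀ i j, 0 ≤ X i j)
    (hY : ∀ i j, 0 ≤ Y i j) (i j : Fin n) : 0 ≤ (X * Y) i j := by
  rw [Matrix.mul_apply]
  exact Finset.sum_nonneg fun k _ => mul_nonneg (hX i k) (hY k j)

theorem stmt14 {n : ℕ} (A : Matrix (Fin n) (Fin n) ℤ) (a b c : ℤ)
    (hsymm : ∀ i j, A i j = A j i)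
    (hdiag : ∀ i, A i i = 0)
    (hent : ∀ i j, A i j = -1 ∨ A i j = 0 ∨ A i j = 1)
    (hconn : (SimpleGraph.fromRel (fun i j => A i j ≠ 0)).Connected)
    (hncomp : ¬ ∀ i j : Fin n, i ≠ j → A i j ≠ 0)
    (hinhom : (∃ i j, A i j = 1) ∧ (∃ i j, A i j = -1))
    (hreg : ∀ i, (Finset.univ.filter (fun j => A i j ≠ 0)).card = 6)
    (hnet : ∀ i, ∑ j, A i j = 2)
    (hAA : ∀ i, (A * A) i i = 6)
    (hpos : ∀ i j, A i j = 1 → (A * A) i j = a)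
    (hneg : ∀ i j, A i j = -1 → (A * A) i j = b)
    (hnon : ∀ i j, i ≠ j → A i j = 0 → (A * A) i j = c)
    (hclass : ¬(a = -b ∧ c = 0) ∧ ¬(a ≠ -b ∧ 2 * c = a + b))
    (hab : a = 1 ∧ b = 1) :
    n = 15 ∧ c = -1 ∧
    (∀ i j : Fin n, A i j ≠ 0 →
      (Finset.univ.filter (fun k => A i k ≠ 0 ∧ A j k ≠ 0)).card = 1) ∧
    (∀ i j : Fin n, i ≠ j → A i j = 0 →
      (Finset.univ.filter (fun k => A i k ≠ 0 ∧ A j k ≠ 0)).card = 3) := by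
  obtain ⟨rfl, rfl⟩ := hab
  obtain ⟨u₀, v₀, huv, hA0⟩ : ∃ i j, i ≠ j ∧ A i j = 0 := by
    push Not at hncomp
    exact hncomp
  have hc1 : c ≠ 1 := by
    intro h
    exact hclass.2 ⟨by norm_num, by omega⟩
  clear hconn hinhom hclass hncomp
  set B : Matrix (Fin n) (Fin n) ℤ := Matrix.of fun i j => if A i j ≠ 0 then 1 else 0 with hBdef
  set P : Matrix (Fin n) (Fin n) ℤ := Matrix.of fun i j => if A i j = 1 then 1 else 0 with hPdef
  set N : Matrix (Fin n) (Fin n) ℤ := Matrix.of fun i j => if A i j = -1 then 1 else 0 with hNdef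
  have hBsymm : ∀ i j, B i j = B j i := fun i j => by simp [hBdef, hsymm i j]
  have hNsymm : ∀ i j, N i j = N j i := fun i j => by simp [hNdef, hsymm i j]
  have hB01 : ∀ i j, B i j = 0 ∨ B i j = 1 := fun i j => by
    by_cases h : A i j = 0 <;> simp [hBdef, h]
  have hP0 : ∀ i j, 0 ≤ P i j := fun i j => by
    by_cases h : A i j = 1 <;> simp [hPdef, h]
  have hP1 : ∀ i j, P i j ≤ 1 := fun i j => by
    by_cases h : A i j = 1 <;> simp [hPdef, h]
  have hN0 : ∀ i j, 0 ≤ N i j := fun i j => by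
    by_cases h : A i j = -1 <;> simp [hNdef, h]
  have hB0 : ∀ i j, A i j = 0 → B i j = 0 := fun i j h => by simp [hBdef, h]
  have hB1 : ∀ i j, A i j ≠ 0 → B i j = 1 := fun i j h => by simp [hBdef, h]
  have hAPN : A = P - N := by
    ext i j
    rcases hent i j with h | h | h <;> simp [hPdef, hNdef, h]
  have hBPN : B = P + N := by
    ext i j
    rcases hent i j with h | h | h <;> simp [hPdef, hNdef, hBdef, h]
  have hBrow : ∀ i, ∑ j, B i j = 6 := fun i => by
    simp only [hBdef, Matrix.of_apply, Finset.sum_boole, hreg i]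
    norm_num
  have hrows : ∀ i, ∑ j, P i j = 4 ∧ ∑ j, N i j = 2 := fun i => by
    have h1 := hnet i
    have h2 := hBrow i
    simp only [hAPN, Matrix.sub_apply, Finset.sum_sub_distrib] at h1
    simp only [hBPN, Matrix.add_apply, Finset.sum_add_distrib] at h2
    omega
  have hsq : A * A = (1 - c) • B + (6 - c) • (1 : Matrix (Fin n) (Fin n) ℤ)
      + c • Matrix.of fun _ _ => 1 := by
    ext i j
    simp only [Matrix.add_apply, Matrix.smul_apply, Matrix.of_apply, smul_eq_mul, mul_one]
    by_cases hij : i = j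
    · subst hij
      rw [hAA, hB0 i i (hdiag i), Matrix.one_apply_eq]
      ring
    · rw [Matrix.one_apply_ne hij]
      rcases hent i j with h | h | h
      · rw [hneg i j h, hB1 i j (by omega)]
        ring
      · rw [hnon i j hij h, hB0 i j h]
        ring
      · rw [hpos i j h, hB1 i j (by omega)]
        ring
  have hcomm : P * N = N * P := by
    refine commute_parts hAPN hBPN (commute_of_sq_eq hnet (fun j => ?_) (by omega) hsq)
    simp only [hsymm _ j, hnet]
  have hBB : ∀ i j, (B * B) i j = (A * A) i j + 4 * (P * N) i j := fun i j => by
    have h : B * B = A * A + (4 : ℤ) • (P * N) := by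
      have h' : B * B = A * A + (2 : ℤ) • (P * N) + (2 : ℤ) • (N * P) := by
        rw [hAPN, hBPN]; noncomm_ring
      rw [h', ← hcomm]; module
    rw [h]; simp [-zsmul_eq_mul]
  have hT : ∀ i j, 0 ≤ (A * A) i j + 2 * (P * N) i j := fun i j => by
    have h : A * A + (2 : ℤ) • (P * N) = P * P + N * N := by
      have h' : A * A + (P * N) + (N * P) = P * P + N * N := by
        rw [hAPN]; noncomm_ring
      rw [← h', ← hcomm]; module
    have h2 : (A * A + (2 : ℤ) • (P * N)) i j = (A * A) i j + 2 * (P * N) i j := by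
      simp [-zsmul_eq_mul]
    rw [← h2, h, Matrix.add_apply]
    exact add_nonneg (mul_apply_nonneg hP0 hP0 i j) (mul_apply_nonneg hN0 hN0 i j)
  have hQ0 : ∀ i j, 0 ≤ (P * N) i j := mul_apply_nonneg hP0 hN0
  have hQ2 : ∀ i j, (P * N) i j ≤ 2 := fun i j => by
    rw [← (hrows j).2, Matrix.mul_apply]
    refine Finset.sum_le_sum fun k _ => ?_
    rw [hNsymm j k]
    exact mul_le_of_le_one_left (hN0 k j) (hP1 i k)
  have hQrow : ∀ i, ∑ j, (P * N) i j = 8 :=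
    sum_mul_apply_of_row_sums (fun i => (hrows i).1) (fun i => (hrows i).2)
  have hcn : c * ((n : ℤ) - 7) = -8 := by
    have h := sum_mul_apply_of_row_sums hnet hnet u₀
    simp only [hsq, Matrix.add_apply, Matrix.smul_apply, Finset.sum_add_distrib, smul_eq_mul,
      ← Finset.mul_sum, hBrow, Matrix.one_apply, Matrix.of_apply, Finset.sum_ite_eq,
      Finset.mem_univ, if_true, Finset.sum_const, Finset.card_univ, Fintype.card_fin,
      nsmul_eq_mul, mul_one] at h
    linarith
  have hBBsum : ∀ i j, (B * B) i j = ∑ k, B i k * B j k := fun i j => by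
    rw [Matrix.mul_apply]
    exact Finset.sum_congr rfl fun k _ => by rw [hBsymm k j]
  have hcard : ∀ i j, (((Finset.univ.filter (fun k => A i k ≠ 0 ∧ A j k ≠ 0)).card : ℕ) : ℤ)
      = (B * B) i j := fun i j => by
    rw [hBBsum, ← Finset.sum_boole]
    refine Finset.sum_congr rfl fun k _ => ?_
    by_cases h1 : A i k = 0 <;> by_cases h2 : A j k = 0 <;> simp [hBdef, h1, h2]
  have hlower : ∀ i j, i ≠ j → A i j = 0 → 14 - (n : ℤ) ≤ (B * B) i j := fun i j hij h => by
    have h1 := add_le_sum_of_nonneg (fun k => (1 - B i k) * (1 - B j k))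
      (fun k => by rcases hB01 i k with h | h <;> rcases hB01 j k with h' | h' <;> simp [h, h'])
      hij
    have e : ∑ k, (1 - B i k) * (1 - B j k)
        = ∑ _k : Fin n, (1 : ℤ) - ∑ k, B i k - ∑ k, B j k + ∑ k, B i k * B j k := by
      rw [← Finset.sum_sub_distrib, ← Finset.sum_sub_distrib, ← Finset.sum_add_distrib]
      exact Finset.sum_congr rfl fun k _ => by ring
    rw [e, hBrow, hBrow, ← hBBsum] at h1
    simp [hB0 i i (hdiag i), hB0 j j (hdiag j), hB0 i j h, hB0 j i (hsymm i j ▸ h)] at h1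
    linarith
  have hcge : -4 ≤ c := by
    have h1 := hT u₀ v₀
    have h2 := hQ2 u₀ v₀
    rw [hnon u₀ v₀ huv hA0] at h1
    omega
  have hcneg : c < 0 := by
    by_contra hc
    have hn : (n : ℤ) < 7 := by nlinarith
    have hle : ∑ j, B u₀ j + 2 ≤ n := by
      have h1 := add_le_sum_of_nonneg (fun k => 1 - B u₀ k)
        (fun k => by rcases hB01 u₀ k with h | h <;> simp [h]) huv
      simp [hB0 u₀ u₀ (hdiag u₀), hB0 u₀ v₀ hA0, Finset.sum_sub_distrib] at h1
      linarith
    rw [hBrow] at hle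
    omega
  have hcm1 : c = -1 := by
    obtain rfl | rfl | rfl | rfl : c = -4 ∨ c = -3 ∨ c = -2 ∨ c = -1 := by omega
    · exfalso
      have h1 := hlower u₀ v₀ huv hA0
      have h2 := hBB u₀ v₀
      have h3 := hQ2 u₀ v₀
      rw [hnon u₀ v₀ huv hA0] at h2
      omega
    · omega
    · exfalso
      have hn : (n : ℤ) = 11 := by omega
      -- Distinct non-adjacent vertices have the same neighbourhood.
      have hsame : ∀ i j, A i j = 0 → ∀ k, A i k ≠ 0 → A j k ≠ 0 := by
        intro i j h k hik hjk
        by_cases hij : i = j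
        · exact hik (hij ▸ hjk)
        have h1 := hlower i j hij h
        have h2 := hBB i j
        have h3 := hQ2 i j
        rw [hnon i j hij h] at h2
        have h4 : ∑ k, B i k * (1 - B j k) = 0 := by
          simp only [mul_sub, mul_one, Finset.sum_sub_distrib, hBrow, ← hBBsum]
          omega
        have h5 := (Finset.sum_eq_zero_iff_of_nonneg (fun k _ => by
          rcases hB01 i k with h | h <;> rcases hB01 j k with h' | h' <;> simp [h, h'])).1 h4 k
          (Finset.mem_univ k)
        simp [hB1 i k hik, hB0 j k hjk] at h5
      obtain ⟨v, hv⟩ : ∃ v, A u₀ v ≠ 0 := by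
        by_contra! h
        have := hnet u₀
        simp [h] at this
      obtain ⟨w, hw⟩ : ∃ w, A u₀ w * A w v ≠ 0 := by
        by_contra! h
        have h1 : (A * A) u₀ v = 0 := by simp [Matrix.mul_apply, h]
        rcases hent u₀ v with h2 | h2 | h2
        · rw [hneg _ _ h2] at h1; omega
        · exact hv h2
        · rw [hpos _ _ h2] at h1; omega
      have hwu : A u₀ w ≠ 0 := left_ne_zero_of_mul hw
      have hwv : A v w ≠ 0 := hsymm w v ▸ right_ne_zero_of_mul hw
      have hk : ∀ k, (1 - B u₀ k) + (1 - B v k) ≤ B w k := by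
        intro k
        by_cases h1 : A u₀ k = 0
        · rw [hB0 _ _ h1, hB1 v k (hsymm v k ▸ hsame _ _ h1 v hv),
            hB1 w k (hsymm w k ▸ hsame _ _ h1 w hwu)]
          norm_num
        · rw [hB1 _ _ h1]
          by_cases h2 : A v k = 0
          · rw [hB0 _ _ h2, hB1 w k (hsymm w k ▸ hsame _ _ h2 w hwv)]
            norm_num
          · rw [hB1 _ _ h2]
            rcases hB01 w k with h | h <;> simp [h]
      have := Finset.sum_le_sum fun k (_ : k ∈ Finset.univ) => hk k
      simp [Finset.sum_add_distrib, Finset.sum_sub_distrib, hBrow] at this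
      omega
    · rfl
  subst hcm1
  have hn : n = 15 := by omega
  have hlow : ∀ i j, 0 ≤ (P * N) i j - (1 - B i j - (1 : Matrix (Fin n) (Fin n) ℤ) i j) := by
    intro i j
    have h0 := hQ0 i j
    by_cases hij : i = j
    · subst hij
      simpa [hB0 i i (hdiag i)] using h0
    · by_cases h : A i j = 0
      · have h1 := hT i j
        rw [hnon i j hij h] at h1
        simp only [hB0 i j h, Matrix.one_apply_ne hij]
        omega
      · simp only [hB1 i j h, Matrix.one_apply_ne hij]
        omega
  have hQ : ∀ i j, (P * N) i j = 1 - B i j - (1 : Matrix (Fin n) (Fin n) ℤ) i j := by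
    intro i j
    have hs : ∑ j, ((P * N) i j - (1 - B i j - (1 : Matrix (Fin n) (Fin n) ℤ) i j)) = 0 := by
      simp only [Finset.sum_sub_distrib, hQrow, hBrow]
      simp [Matrix.one_apply, hn]
    exact sub_eq_zero.mp ((Finset.sum_eq_zero_iff_of_nonneg fun k _ => hlow i k).1 hs j
      (Finset.mem_univ j))
  refine ⟨hn, rfl, fun i j h => ?_, fun i j hij h => ?_⟩
  · have hij : i ≠ j := fun e => h (e ▸ hdiag i)
    have h1 := hBB i j
    have h2 : (A * A) i j = 1 := by
      rcases hent i j with h' | h' | h'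
      · exact hneg i j h'
      · exact absurd h' h
      · exact hpos i j h'
    rw [hQ, h2, hB1 i j h, Matrix.one_apply_ne hij, ← hcard] at h1
    omega
  · have h1 := hBB i j
    rw [hQ, hnon i j hij h, hB0 i j h, Matrix.one_apply_ne hij, ← hcard] at h1
    omega
end

section
/- Let A be the adjacency matrix of a connected, non-complete, inhomogeneous, 6-regular and 2 net-regular strongly regular signed graph with parameters (n, 6, a, b, c) lying in the class C1 ∪ C4 ∪ C5. Then (a, b) ≠ (2, 1); and if (a, b) = (3, 1), then n = 15, c = -2, the graph on the same vertex set whose edges are the pairs {i, j} with A i j = 1 is a disjoint union of copies of K₅, and the graph whose edges are the pairs {i, j} with A i j = -1 is a disjoint union of copies of K₃. -/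
namespace SignedGraph

open Finset

/-- The number of `j` with `A i j = s`. -/
def signedDegree {n : ℕ} (A : Matrix (Fin n) (Fin n) ℤ) (s : ℤ) (i : Fin n) : ℕ :=
  #{j | A i j = s}

/-- The number of walks of length two from `i` to `j` whose steps have signs `s` and `t`. -/
def signedWalks {n : ℕ} (A : Matrix (Fin n) (Fin n) ℤ) (s t : ℤ) (i j : Fin n) : ℕ :=
  #{k | A i k = s ∧ A k j = t}

/-- A symmetric irreflexive `d`-regular relation in which adjacent vertices have `d - 1` common
neighbours is a disjoint union of cliques of size `d + 1`. -/
theorem exists_finpartition_of_card_common {α : Type*} [Fintype α] [DecidableEq α]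
    (r : α → α → Prop) [hr : ∀ i j, Decidable (r i j)] (d : ℕ) (hsymm : ∀ i j, r i j → r j i)
    (hirr : ∀ i, ¬ r i i) (hdeg : ∀ i, #{j | r i j} = d)
    (hcommon : ∀ i j, r i j → #{k | r i k ∧ r k j} + 1 = d) :
    ∃ P : Finpartition (univ : Finset α), (∀ s ∈ P.parts, #s = d + 1) ∧
      ∀ i j, r i j ↔ i ≠ j ∧ ∃ s ∈ P.parts, i ∈ s ∧ j ∈ s := by
  have htrans : ∀ i j k, r i j → r j k → i ≠ k → r i k := by
    intro i j k hij hjk hik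
    have hsub : ({l | r i l ∧ r l j} : Finset α) ⊆ ({l | r j l} : Finset α).erase i := by
      intro l hl
      simp only [mem_filter, mem_univ, true_and, mem_erase] at hl ⊢
      exact ⟨fun h => hirr i (h ▸ hl.1), hsymm _ _ hl.2⟩
    have hi : i ∈ ({l | r j l} : Finset α) := by simpa using hsymm _ _ hij
    have heq := eq_of_subset_of_card_le hsub (by
      rw [card_erase_of_mem hi, hdeg]
      have := hcommon i j hij
      omega)
    have hk : k ∈ ({l | r j l} : Finset α).erase i := by simpa using ⟨hik.symm, hjk⟩
    rw [← heq] at hk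
    simp only [mem_filter] at hk
    exact hk.2.1
  let S : Setoid α :=
    { r := fun i j => i = j ∨ r i j
      iseqv := ⟨fun _ => Or.inl rfl, fun h => h.imp Eq.symm (hsymm _ _), by
        rintro x y z (rfl | hxy) (rfl | hyz)
        · exact Or.inl rfl
        · exact Or.inr hyz
        · exact Or.inr hxy
        · by_cases h : x = z
          · exact Or.inl h
          · exact Or.inr (htrans _ _ _ hxy hyz h)⟩ }
  have : DecidableRel S.r := fun i j => inferInstanceAs (Decidable (i = j ∨ r i j))
  refine ⟨Finpartition.ofSetoid S, fun s hs => ?_, fun i j => ?_⟩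
  · obtain ⟨i, -, rfl⟩ : ∃ i ∈ (univ : Finset α), ({j | S.r i j} : Finset α) = s := by
      simpa [Finpartition.ofSetoid, Finpartition.ofSetSetoid] using hs
    have : ({j | S.r i j} : Finset α) = insert i ({j | r i j} : Finset α) := by
      ext j
      simp only [mem_filter, mem_univ, true_and, mem_insert, eq_comm (a := j)]
      exact Iff.rfl
    rw [this, card_insert_of_notMem (by simpa using hirr i), hdeg]
  · have hpart : (∃ s ∈ (Finpartition.ofSetoid S).parts, i ∈ s ∧ j ∈ s) ↔ S.r i j := by
      rw [← Finpartition.mem_part_iff_exists, Finpartition.mem_part_ofSetoid_iff_rel]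
      exact ⟨fun h => S.iseqv.symm h, fun h => S.iseqv.symm h⟩
    rw [hpart]
    refine ⟨fun h => ⟨fun e => hirr i (by simpa [← e] using h), Or.inr h⟩, ?_⟩
    rintro ⟨hne, h | h⟩
    · exact absurd h hne
    · exact h

theorem dvd_of_finpartition {n m : ℕ} (P : Finpartition (univ : Finset (Fin n)))
    (hP : ∀ s ∈ P.parts, #s = m) : m ∣ n := by
  have h := P.sum_card_parts
  rw [sum_congr rfl hP, sum_const, card_univ, Fintype.card_fin] at h
  exact ⟨#P.parts, by rw [mul_comm, ← smul_eq_mul, h]⟩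

variable {n : ℕ} {A : Matrix (Fin n) (Fin n) ℤ}

theorem signedWalks_comm (hsymm : ∀ i j, A i j = A j i) (s t : ℤ) (i j : Fin n) :
    signedWalks A s t i j = signedWalks A t s j i := by
  unfold signedWalks
  congr 1
  ext k
  simp [hsymm i k, hsymm k j, and_comm]

theorem signedDegree_eq (hent : ∀ i j, A i j = -1 ∨ A i j = 0 ∨ A i j = 1)
    (hreg : ∀ i, #{j | A i j ≠ 0} = 6) (hnet : ∀ i, ∑ j, A i j = 2) (i : Fin n) :
    signedDegree A 1 i = 4 ∧ signedDegree A (-1) i = 2 := by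
  have hadd : signedDegree A 1 i + signedDegree A (-1) i = 6 := by
    rw [← hreg i]
    simp only [signedDegree, card_filter, ← sum_add_distrib]
    refine sum_congr rfl fun j _ => ?_
    rcases hent i j with h | h | h <;> simp [h]
  have hsub : (signedDegree A 1 i : ℤ) - signedDegree A (-1) i = 2 := by
    rw [← hnet i]
    simp only [signedDegree, card_filter, Nat.cast_sum, ← sum_sub_distrib]
    refine sum_congr rfl fun j _ => ?_
    rcases hent i j with h | h | h <;> simp [h]
  omega

theorem mul_self_apply_eq (hent : ∀ i j, A i j = -1 ∨ A i j = 0 ∨ A i j = 1) (i j : Fin n) :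
    (A * A) i j = signedWalks A 1 1 i j + signedWalks A (-1) (-1) i j
      - signedWalks A 1 (-1) i j - signedWalks A (-1) 1 i j := by
  simp only [Matrix.mul_apply, signedWalks, card_filter, Nat.cast_sum, ← sum_add_distrib,
    ← sum_sub_distrib]
  refine sum_congr rfl fun k _ => ?_
  rcases hent i k with h | h | h <;> rcases hent k j with h' | h' | h' <;> simp [h, h']

theorem signedWalks_add_le (hdiag : ∀ i, A i i = 0) (s : ℤ) (i j : Fin n) :
    signedWalks A s 1 i j + signedWalks A s (-1) i j + (if A i j = s then 1 else 0)
      ≤ signedDegree A s i := by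
  have : (if A i j = s then 1 else 0) = ∑ k, if k = j then (if A i k = s then 1 else 0) else 0 := by
    simp
  rw [this]
  simp only [signedWalks, signedDegree, card_filter, ← sum_add_distrib]
  refine sum_le_sum fun k _ => ?_
  by_cases hk : k = j
  · subst hk
    simp [hdiag]
  · by_cases h : A i k = s
    · by_cases h' : A k j = 1 <;> simp [hk, h, h']
      split_ifs <;> simp
    · simp [h]

/-- Two-walks of mixed sign are balanced when the matrix commutes with its entrywise absolute
value. -/
theorem signedWalks_mixed_eq (hent : ∀ i j, A i j = -1 ∨ A i j = 0 ∨ A i j = 1)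
    (hcomm : A * A.map (fun x => |x|) = A.map (fun x => |x|) * A) (i j : Fin n) :
    signedWalks A 1 (-1) i j = signedWalks A (-1) 1 i j := by
  have h₁ : (A * A.map (fun x => |x|)) i j - (A.map (fun x => |x|) * A) i j =
      2 * signedWalks A 1 (-1) i j - 2 * signedWalks A (-1) 1 i j := by
    simp only [Matrix.mul_apply, Matrix.map_apply, signedWalks, card_filter, Nat.cast_sum,
      mul_sum, ← sum_sub_distrib]
    refine sum_congr rfl fun k _ => ?_
    rcases hent i k with h | h | h <;> rcases hent k j with h' | h' | h' <;> simp [h, h']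
  rw [hcomm, sub_self] at h₁
  omega

theorem commute_map_abs {a b c : ℤ} (hsymm : ∀ i j, A i j = A j i) (hdiag : ∀ i, A i i = 0)
    (hent : ∀ i j, A i j = -1 ∨ A i j = 0 ∨ A i j = 1)
    (hnet : ∀ i, ∑ j, A i j = 2) (hAA : ∀ i, (A * A) i i = 6)
    (hpos : ∀ i j, A i j = 1 → (A * A) i j = a) (hneg : ∀ i j, A i j = -1 → (A * A) i j = b)
    (hnon : ∀ i j, i ≠ j → A i j = 0 → (A * A) i j = c) (hc : a + b - 2 * c ≠ 0) :
    A * A.map (fun x => |x|) = A.map (fun x => |x|) * A := by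
  set J : Matrix (Fin n) (Fin n) ℤ := Matrix.of fun _ _ => 1 with hJ
  have hAJ : A * J = J * A := by
    ext i j
    simp only [hJ, Matrix.mul_apply, Matrix.of_apply, mul_one, one_mul, hnet]
    rw [sum_congr rfl fun k _ => hsymm k j, hnet]
  have hB : (a + b - 2 * c) • A.map (fun x => |x|) =
      (2 : ℤ) • (A * A) - (2 * (6 - c)) • (1 : Matrix (Fin n) (Fin n) ℤ) - (a - b) • A
        - (2 * c) • J := by
    ext i j
    simp only [Matrix.sub_apply, Matrix.smul_apply, Matrix.map_apply, hJ, Matrix.of_apply,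
      smul_eq_mul, mul_one]
    by_cases hij : i = j
    · subst hij
      simp [hdiag, hAA]
      ring
    · rw [Matrix.one_apply_ne hij]
      rcases hent i j with h | h | h
      · rw [hneg i j h, h]
        norm_num
        ring
      · rw [hnon i j hij h, h]
        norm_num
      · rw [hpos i j h, h]
        norm_num
        ring
  have hsmul : (a + b - 2 * c) • (A * A.map (fun x => |x|)) =
      (a + b - 2 * c) • (A.map (fun x => |x|) * A) := by
    rw [← Matrix.mul_smul, ← Matrix.smul_mul, hB]
    simp only [mul_sub, sub_mul, Matrix.mul_smul, Matrix.smul_mul, hAJ, mul_one, one_mul,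
      mul_assoc]
  exact smul_right_injective _ hc hsmul

theorem row_sum_mul_self {a b c : ℤ} (hdiag : ∀ i, A i i = 0)
    (hent : ∀ i j, A i j = -1 ∨ A i j = 0 ∨ A i j = 1)
    (hnet : ∀ i, ∑ j, A i j = 2) (hAA : ∀ i, (A * A) i i = 6)
    (hpos : ∀ i j, A i j = 1 → (A * A) i j = a) (hneg : ∀ i j, A i j = -1 → (A * A) i j = b)
    (hnon : ∀ i j, i ≠ j → A i j = 0 → (A * A) i j = c) (i : Fin n) :
    n * c + (6 - c) + (a - c) * signedDegree A 1 i + (b - c) * signedDegree A (-1) i = 4 := by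
  have h₁ : ∑ j, (A * A) i j = 4 := by
    simp only [Matrix.mul_apply]
    rw [sum_comm]
    simp only [← mul_sum, hnet, ← sum_mul]
    norm_num
  have h₂ : ∀ j, (A * A) i j = c + (if i = j then 6 - c else 0)
      + (a - c) * (if A i j = 1 then 1 else 0) + (b - c) * (if A i j = -1 then 1 else 0) := by
    intro j
    by_cases hij : i = j
    · subst hij
      simp [hdiag, hAA]
    · rcases hent i j with h | h | h
      · simp [hneg i j h, h, hij]
      · simp [hnon i j hij h, h, hij]
      · simp [hpos i j h, h, hij]
  rw [sum_congr rfl fun j _ => h₂ j] at h₁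
  simp only [sum_add_distrib, ← mul_sum, sum_const, card_univ, Fintype.card_fin, nsmul_eq_mul,
    sum_ite_eq, mem_univ, if_true, sum_boole] at h₁
  exact h₁

theorem seven_le_card (hdiag : ∀ i, A i i = 0) (hreg : ∀ i, #{j | A i j ≠ 0} = 6) (i : Fin n) :
    7 ≤ n := by
  have h : #(insert i ({j | A i j ≠ 0} : Finset (Fin n))) = 7 := by
    rw [card_insert_of_notMem (by simp [hdiag]), hreg]
  have h' := card_le_univ (insert i ({j | A i j ≠ 0} : Finset (Fin n)))
  rwa [h, Fintype.card_fin] at h'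

theorem signedWalks_eq_zero_iff {s t : ℤ} {i j : Fin n} :
    signedWalks A s t i j = 0 ↔ ∀ k, ¬ (A i k = s ∧ A k j = t) := by
  simp [signedWalks, filter_eq_empty_iff]

theorem signedWalks_neg_neg_of_neg (hsymm : ∀ i j, A i j = A j i) (hdiag : ∀ i, A i i = 0)
    (hent : ∀ i j, A i j = -1 ∨ A i j = 0 ∨ A i j = 1)
    (hdeg : ∀ i, signedDegree A (-1) i = 2) (hneg : ∀ i j, A i j = -1 → (A * A) i j = 1)
    (hmixed : ∀ i j, A i j = 1 → signedWalks A (-1) 1 i j = 0)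
    {i j : Fin n} (hij : A i j = -1) : signedWalks A (-1) (-1) i j = 1 := by
  have hpp : signedWalks A 1 1 i j = 0 := by
    rw [signedWalks_eq_zero_iff]
    rintro k ⟨hik, hkj⟩
    exact signedWalks_eq_zero_iff.1 (hmixed i k hik) j ⟨hij, by rw [hsymm, hkj]⟩
  have h₁ := mul_self_apply_eq hent i j
  have h₂ := signedWalks_add_le hdiag (-1) i j
  rw [hneg i j hij, hpp] at h₁
  rw [if_pos hij, hdeg] at h₂
  omega

theorem exists_finpartition_of_signedWalks (hsymm : ∀ i j, A i j = A j i)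
    (hdiag : ∀ i, A i i = 0) {s : ℤ} {d : ℕ} (hs : s ≠ 0) (hdeg : ∀ i, signedDegree A s i = d)
    (hwalks : ∀ i j, A i j = s → signedWalks A s s i j + 1 = d) :
    ∃ P : Finpartition (univ : Finset (Fin n)), (∀ t ∈ P.parts, #t = d + 1) ∧
      ∀ i j, A i j = s ↔ i ≠ j ∧ ∃ t ∈ P.parts, i ∈ t ∧ j ∈ t :=
  exists_finpartition_of_card_common (fun i j => A i j = s) d
    (hr := fun i j => decEq (A i j) s) (fun i j h => by rw [hsymm, h])
    (fun i h => hs (by rw [← h, hdiag])) hdeg hwalks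

end SignedGraph

open SignedGraph

theorem stmt15 {n : ℕ} (A : Matrix (Fin n) (Fin n) ℤ) (a b c : ℤ)
    (hsymm : ∀ i j, A i j = A j i)
    (hdiag : ∀ i, A i i = 0)
    (hent : ∀ i j, A i j = -1 ∨ A i j = 0 ∨ A i j = 1)
    (hconn : (SimpleGraph.fromRel (fun i j => A i j ≠ 0)).Connected)
    (hncomp : ¬ ∀ i j : Fin n, i ≠ j → A i j ≠ 0)
    (hinhom : (∃ i j, A i j = 1) ∧ (∃ i j, A i j = -1))
    (hreg : ∀ i, (Finset.univ.filter (fun j => A i j ≠ 0)).card = 6)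
    (hnet : ∀ i, ∑ j, A i j = 2)
    (hAA : ∀ i, (A * A) i i = 6)
    (hpos : ∀ i j, A i j = 1 → (A * A) i j = a)
    (hneg : ∀ i j, A i j = -1 → (A * A) i j = b)
    (hnon : ∀ i j, i ≠ j → A i j = 0 → (A * A) i j = c)
    (hclass : ¬(a = -b ∧ c = 0) ∧ ¬(a ≠ -b ∧ 2 * c = a + b)) :
    ¬(a = 2 ∧ b = 1) ∧
    ((a = 3 ∧ b = 1) → n = 15 ∧ c = -2 ∧
      (∃ P : Finpartition (Finset.univ : Finset (Fin n)),
        (∀ s ∈ P.parts, s.card = 5) ∧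
        (∀ i j : Fin n, A i j = 1 ↔ i ≠ j ∧ ∃ s ∈ P.parts, i ∈ s ∧ j ∈ s)) ∧
      (∃ Q : Finpartition (Finset.univ : Finset (Fin n)),
        (∀ s ∈ Q.parts, s.card = 3) ∧
        (∀ i j : Fin n, A i j = -1 ↔ i ≠ j ∧ ∃ s ∈ Q.parts, i ∈ s ∧ j ∈ s))) := by
  have hdeg := signedDegree_eq hent hreg hnet
  obtain ⟨i₀, -, -⟩ := hinhom.1
  have hrow := row_sum_mul_self hdiag hent hnet hAA hpos hneg hnon i₀
  rw [(hdeg i₀).1, (hdeg i₀).2] at hrow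
  have hn7 := seven_le_card hdiag hreg i₀
  have hc4 : -4 ≤ c := by
    push Not at hncomp
    obtain ⟨i, j, hij, h⟩ := hncomp
    have h₁ := mul_self_apply_eq hent i j
    have h₂ := signedWalks_add_le hdiag (-1) i j
    have h₃ := signedWalks_add_le hdiag (-1) j i
    rw [signedWalks_comm hsymm (-1) 1 j i] at h₃
    rw [hnon i j hij h] at h₁
    rw [(hdeg _).2] at h₂ h₃
    omega
  have hbound : ∀ i j, A i j = 1 →
      a = signedWalks A 1 1 i j + signedWalks A (-1) (-1) i j
        - signedWalks A 1 (-1) i j - signedWalks A (-1) 1 i j ∧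
      signedWalks A 1 1 i j + signedWalks A 1 (-1) i j ≤ 3 ∧
      signedWalks A (-1) 1 i j + signedWalks A (-1) (-1) i j ≤ 2 ∧
      signedWalks A 1 1 i j + signedWalks A (-1) 1 i j ≤ 3 ∧
      signedWalks A 1 (-1) i j + signedWalks A (-1) (-1) i j ≤ 2 := by
    intro i j hij
    have hji : A j i = 1 := by rw [hsymm, hij]
    have h₁ := signedWalks_add_le hdiag 1 i j
    have h₂ := signedWalks_add_le hdiag (-1) i j
    have h₃ := signedWalks_add_le hdiag 1 j i
    have h₄ := signedWalks_add_le hdiag (-1) j i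
    rw [signedWalks_comm hsymm 1 1 j i, signedWalks_comm hsymm 1 (-1) j i, if_pos hji,
      (hdeg _).1] at h₃
    rw [signedWalks_comm hsymm (-1) 1 j i, signedWalks_comm hsymm (-1) (-1) j i,
      (hdeg _).2] at h₄
    rw [if_pos hij, (hdeg _).1] at h₁
    rw [(hdeg _).2] at h₂
    refine ⟨by rw [← hpos i j hij, mul_self_apply_eq hent], ?_, ?_, ?_, ?_⟩ <;> omega
  have htriangles : b = 1 → (∀ i j, A i j = 1 → signedWalks A (-1) 1 i j = 0) →
      ∃ Q : Finpartition (Finset.univ : Finset (Fin n)), (∀ s ∈ Q.parts, s.card = 3) ∧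
        (∀ i j : Fin n, A i j = -1 ↔ i ≠ j ∧ ∃ s ∈ Q.parts, i ∈ s ∧ j ∈ s) := by
    rintro rfl hmixed
    refine exists_finpartition_of_signedWalks hsymm hdiag (by norm_num) (fun i => (hdeg i).2)
      fun i j hij => ?_
    rw [signedWalks_neg_neg_of_neg hsymm hdiag hent (fun i => (hdeg i).2) hneg hmixed hij]
  constructor
  · rintro ⟨rfl, rfl⟩
    have hc : c < 0 := by push_cast at hrow; nlinarith
    have hcomm := commute_map_abs hsymm hdiag hent hnet hAA hpos hneg hnon (by omega)
    obtain ⟨Q, hQ, -⟩ := htriangles rfl fun i j hij => by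
      have h₁ := hbound i j hij
      have h₂ := signedWalks_mixed_eq hent hcomm i j
      omega
    have hdvd := dvd_of_finpartition Q hQ
    interval_cases c <;> omega
  · rintro ⟨rfl, rfl⟩
    have hc : c < 0 := by push_cast at hrow; nlinarith
    have hmixed : ∀ i j, A i j = 1 →
        signedWalks A (-1) 1 i j = 0 ∧ signedWalks A 1 (-1) i j = 0 := by
      intro i j hij
      have := hbound i j hij
      omega
    obtain ⟨Q, hQ, hQA⟩ := htriangles rfl fun i j hij => (hmixed i j hij).1
    have hnn : ∀ i j, A i j = 1 → signedWalks A (-1) (-1) i j = 0 := by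
      intro i j hij
      rw [signedWalks_eq_zero_iff]
      rintro k ⟨hik, hkj⟩
      obtain ⟨-, s, hs, his, hks⟩ := (hQA i k).1 hik
      obtain ⟨-, t, ht, hkt, hjt⟩ := (hQA k j).1 hkj
      obtain rfl := Q.eq_of_mem_parts hs ht hks hkt
      have hne : i ≠ j := by
        rintro rfl
        simp [hdiag] at hij
      have := (hQA i j).2 ⟨hne, s, hs, his, hjt⟩
      omega
    obtain ⟨P, hP, hPA⟩ := exists_finpartition_of_signedWalks hsymm hdiag one_ne_zero
      (fun i => (hdeg i).1) fun i j hij => by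
        have h₁ := hbound i j hij
        have h₂ := hmixed i j hij
        have h₃ := hnn i j hij
        omega
    have hdvd := dvd_of_finpartition P hP
    have hnc : n = 15 ∧ c = -2 := by interval_cases c <;> omega
    exact ⟨hnc.1, hnc.2, ⟨P, hP, hPA⟩, ⟨Q, hQ, hQA⟩⟩
end

section
/- Let A be the adjacency matrix of a connected, non-complete, inhomogeneous, 6-regular and 2 net-regular strongly regular signed graph with parameters (n, 6, a, b, c) lying in the class C1 ∪ C4 ∪ C5. If every triangle of A is balanced (for all pairwise adjacent i, j, k one has A i j · A j k · A i k = 1), then: (1) a ∈ {0, 1, 2, 3} and b ∈ {-2, 0}; (2) if a = 0 then any two positively adjacent vertices have no common neighbours, and if b = 0 then any two negatively adjacent vertices have no common neighbours. -/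
open Finset

/-- The `0/1` adjacency matrices `P`, `N` of the positive and negative edges of a `6`-regular,
`2` net-regular signed graph all of whose triangles are balanced. -/
structure IsBalancedPair {V : Type*} [Fintype V] (P N : Matrix V V ℤ) : Prop where
  pos_symm : ∀ i j, P i j = P j i
  neg_symm : ∀ i j, N i j = N j i
  pos_diag : ∀ i, P i i = 0
  neg_diag : ∀ i, N i i = 0
  pos_mem : ∀ i j, P i j = 0 ∨ P i j = 1
  neg_mem : ∀ i j, N i j = 0 ∨ N i j = 1
  disjoint : ∀ i j, P i j * N i j = 0
  pos_sum : ∀ i, ∑ j, P i j = 4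
  neg_sum : ∀ i, ∑ j, N i j = 2
  no_pos_pos_neg : ∀ i j k, P i j * (P j k * N i k) = 0
  no_neg_neg_neg : ∀ i j k, N i j * (N j k * N i k) = 0

/-- A symmetric sum vanishing on the diagonal is even. -/
theorem even_sum_of_symm_of_diag_zero {V : Type*} [Fintype V] (f : V → V → ℤ)
    (hsymm : ∀ i j, f i j = f j i) (hdiag : ∀ i, f i i = 0) : Even (∑ i, ∑ j, f i j) := by
  rw [← Fintype.sum_prod_type' f, ← ZMod.intCast_eq_zero_iff_even, Int.cast_sum]
  refine sum_involution (fun p _ => p.swap) ?_ ?_ (fun _ _ => mem_univ _)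
    (fun _ _ => Prod.swap_swap _)
  · rintro ⟨i, j⟩ -
    rw [Prod.swap_prod_mk, hsymm j i, CharTwo.add_self_eq_zero]
  · rintro ⟨i, j⟩ - h heq
    obtain rfl : j = i := congrArg Prod.fst heq
    exact h (by simp [hdiag])

namespace IsBalancedPair

variable {V : Type*} [Fintype V] {P N : Matrix V V ℤ}

theorem pos_nonneg (h : IsBalancedPair P N) (i j : V) : 0 ≤ P i j := by
  rcases h.pos_mem i j with h | h <;> simp [h]

theorem neg_nonneg (h : IsBalancedPair P N) (i j : V) : 0 ≤ N i j := by
  rcases h.neg_mem i j with h | h <;> simp [h]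

theorem pos_le_one (h : IsBalancedPair P N) (i j : V) : P i j ≤ 1 := by
  rcases h.pos_mem i j with h | h <;> simp [h]

theorem pos_mul_pos_nonneg (h : IsBalancedPair P N) (i j : V) : 0 ≤ (P * P) i j :=
  sum_nonneg fun _ _ => mul_nonneg (h.pos_nonneg _ _) (h.pos_nonneg _ _)

theorem neg_mul_neg_nonneg (h : IsBalancedPair P N) (i j : V) : 0 ≤ (N * N) i j :=
  sum_nonneg fun _ _ => mul_nonneg (h.neg_nonneg _ _) (h.neg_nonneg _ _)

theorem neg_mul_pos_nonneg (h : IsBalancedPair P N) (i j : V) : 0 ≤ (N * P) i j :=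
  sum_nonneg fun _ _ => mul_nonneg (h.neg_nonneg _ _) (h.pos_nonneg _ _)

theorem neg_mul_pos_le_two (h : IsBalancedPair P N) (i j : V) : (N * P) i j ≤ 2 := by
  rw [← h.neg_sum i, Matrix.mul_apply]
  exact sum_le_sum fun k _ => mul_le_of_le_one_right (h.neg_nonneg i k) (h.pos_le_one k j)

theorem pos_mul_neg_apply (h : IsBalancedPair P N) (i j : V) : (P * N) i j = (N * P) j i := by
  simp only [Matrix.mul_apply]
  exact sum_congr rfl fun k _ => by rw [h.pos_symm i k, h.neg_symm k j, mul_comm]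

theorem pos_mul_pos_le_three (h : IsBalancedPair P N) {i j : V} (hij : P i j = 1) :
    (P * P) i j ≤ 3 := by
  classical
  have hsum : ∑ k, (P i k - if k = j then 1 else 0) = 3 := by
    simp [sum_sub_distrib, h.pos_sum]
  rw [← hsum, Matrix.mul_apply]
  refine sum_le_sum fun k _ => ?_
  split_ifs with hk
  · simp [hk, hij, h.pos_diag]
  · simpa using mul_le_of_le_one_right (h.pos_nonneg i k) (h.pos_le_one k j)

theorem neg_mul_pos_le_one (h : IsBalancedPair P N) {i j : V} (hij : N i j = 1) :
    (N * P) i j ≤ 1 := by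
  classical
  have hsum : ∑ k, (N i k - if k = j then 1 else 0) = 1 := by
    simp [sum_sub_distrib, h.neg_sum]
  rw [← hsum, Matrix.mul_apply]
  refine sum_le_sum fun k _ => ?_
  split_ifs with hk
  · simp [hk, hij, h.pos_diag]
  · simpa using mul_le_of_le_one_right (h.neg_nonneg i k) (h.pos_le_one k j)

theorem neg_mul_pos_eq_zero (h : IsBalancedPair P N) {i j : V} (hij : P i j = 1) :
    (N * P) i j = 0 := by
  rw [Matrix.mul_apply]
  refine sum_eq_zero fun k _ => ?_
  have := h.no_pos_pos_neg i j k
  rwa [hij, one_mul, h.pos_symm j k, mul_comm] at this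

theorem pos_mul_pos_eq_zero (h : IsBalancedPair P N) {i j : V} (hij : N i j = 1) :
    (P * P) i j = 0 := by
  rw [Matrix.mul_apply]
  refine sum_eq_zero fun k _ => ?_
  simpa [hij] using h.no_pos_pos_neg i k j

theorem neg_mul_neg_eq_zero (h : IsBalancedPair P N) {i j : V} (hij : N i j = 1) :
    (N * N) i j = 0 := by
  rw [Matrix.mul_apply]
  refine sum_eq_zero fun k _ => ?_
  simpa [hij] using h.no_neg_neg_neg i k j

theorem neg_mul_pos_diag (h : IsBalancedPair P N) (i : V) : (N * P) i i = 0 := by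
  rw [Matrix.mul_apply]
  exact sum_eq_zero fun k _ => by rw [h.pos_symm k i, mul_comm, h.disjoint]

theorem sub_mul_sub_apply (h : IsBalancedPair P N) (i j : V) :
    ((P - N) * (P - N)) i j =
      (P * P) i j + (N * N) i j - (N * P) i j - (N * P) j i := by
  rw [Matrix.sub_mul, Matrix.mul_sub, Matrix.mul_sub]
  simp only [Matrix.sub_apply]
  linarith [h.pos_mul_neg_apply i j]

theorem sum_sum_pos (h : IsBalancedPair P N) : ∑ i, ∑ j, P i j = 4 * (Fintype.card V : ℤ) := by
  simp [h.pos_sum, mul_comm]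

theorem sum_sum_neg (h : IsBalancedPair P N) : ∑ i, ∑ j, N i j = 2 * (Fintype.card V : ℤ) := by
  simp [h.neg_sum, mul_comm]

theorem sum_sum_neg_mul_pos (h : IsBalancedPair P N) :
    ∑ i, ∑ j, (N * P) i j = 8 * (Fintype.card V : ℤ) := by
  have hrow (i : V) : ∑ j, (N * P) i j = 8 := by
    simp only [Matrix.mul_apply]
    rw [sum_comm]
    simp only [← mul_sum, h.pos_sum, ← sum_mul, h.neg_sum]
    norm_num
  simp [hrow, mul_comm]

/-- Two ways of counting the triangles with two negative edges. -/
theorem sum_sum_mul_neg_mul_pos (h : IsBalancedPair P N) :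
    ∑ i, ∑ j, N i j * (N * P) i j = ∑ i, ∑ j, P i j * (N * N) i j := by
  simp only [Matrix.mul_apply, mul_sum]
  rw [sum_congr rfl fun i _ => sum_comm, sum_comm]
  refine sum_congr rfl fun k _ => ?_
  rw [sum_comm]
  refine sum_congr rfl fun j _ => sum_congr rfl fun i _ => ?_
  rw [h.neg_symm k i]
  ring

theorem even_sum_sum_mul_neg_mul_neg (h : IsBalancedPair P N) :
    Even (∑ i, ∑ j, P i j * (N * N) i j) := by
  refine even_sum_of_symm_of_diag_zero _ (fun i j => ?_) fun i => by simp [h.pos_diag]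
  rw [h.pos_symm i j]
  simp only [Matrix.mul_apply]
  exact congrArg _ (sum_congr rfl fun k _ => by
    rw [h.neg_symm i k, h.neg_symm k j, mul_comm])

variable {a b c : ℤ}

theorem pos_param_eq (h : IsBalancedPair P N)
    (hpos : ∀ i j, P i j = 1 → ((P - N) * (P - N)) i j = a) {i j : V} (hij : P i j = 1) :
    (P * P) i j + (N * N) i j = a := by
  have := hpos i j hij
  rw [h.sub_mul_sub_apply, h.neg_mul_pos_eq_zero hij,
    h.neg_mul_pos_eq_zero (h.pos_symm i j ▸ hij)] at this
  linarith

theorem pos_param_nonneg (h : IsBalancedPair P N)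
    (hpos : ∀ i j, P i j = 1 → ((P - N) * (P - N)) i j = a) {i j : V} (hij : P i j = 1) :
    0 ≤ a := by
  rw [← h.pos_param_eq hpos hij]
  exact add_nonneg (h.pos_mul_pos_nonneg i j) (h.neg_mul_neg_nonneg i j)

theorem sum_sum_mul_neg_mul_neg_le (h : IsBalancedPair P N)
    (hpos : ∀ i j, P i j = 1 → ((P - N) * (P - N)) i j = a) :
    ∑ i, ∑ j, P i j * (N * N) i j ≤ a * (4 * Fintype.card V) := by
  rw [← h.sum_sum_pos]
  simp only [mul_sum]
  refine sum_le_sum fun i _ => sum_le_sum fun j _ => ?_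
  rcases h.pos_mem i j with hij | hij
  · simp [hij]
  · rw [hij]
    linarith [h.pos_param_eq hpos hij, h.pos_mul_pos_nonneg i j]

theorem pos_param_le_three (h : IsBalancedPair P N) (hV : 0 < Fintype.card V)
    (hpos : ∀ i j, P i j = 1 → ((P - N) * (P - N)) i j = a) : a ≤ 3 := by
  have h1 : a * ∑ i, ∑ j, P i j ≤
      ∑ i, ∑ j, P i j * (N * N) i j + 3 * ∑ i, ∑ j, P i j := by
    simp only [mul_sum, ← sum_add_distrib]
    refine sum_le_sum fun i _ => sum_le_sum fun j _ => ?_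
    rcases h.pos_mem i j with hij | hij
    · simp [hij]
    · rw [hij]
      linarith [h.pos_param_eq hpos hij, h.pos_mul_pos_le_three hij]
  have h2 : ∑ i, ∑ j, N i j * (N * P) i j ≤ ∑ i, ∑ j, N i j := by
    refine sum_le_sum fun i _ => sum_le_sum fun j _ => ?_
    rcases h.neg_mem i j with hij | hij
    · simp [hij]
    · simpa [hij] using h.neg_mul_pos_le_one hij
  rw [h.sum_sum_pos] at h1
  rw [h.sum_sum_mul_neg_mul_pos, h.sum_sum_neg] at h2
  have : (0 : ℤ) < Fintype.card V := by exact_mod_cast hV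
  by_contra! ha
  nlinarith

theorem neg_param_eq (h : IsBalancedPair P N)
    (hneg : ∀ i j, N i j = 1 → ((P - N) * (P - N)) i j = b) {i j : V} (hij : N i j = 1) :
    (N * P) i j + (N * P) j i = -b := by
  have := hneg i j hij
  rw [h.sub_mul_sub_apply, h.pos_mul_pos_eq_zero hij, h.neg_mul_neg_eq_zero hij] at this
  linarith

theorem neg_param_mem_Icc (h : IsBalancedPair P N)
    (hneg : ∀ i j, N i j = 1 → ((P - N) * (P - N)) i j = b) {i j : V} (hij : N i j = 1) :
    b ∈ Set.Icc (-2) 0 := by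
  have h0 := h.neg_param_eq hneg hij
  have h1 := h.neg_mul_pos_le_one hij
  have h2 := h.neg_mul_pos_le_one (h.neg_symm i j ▸ hij)
  have h3 := h.neg_mul_pos_nonneg i j
  have h4 := h.neg_mul_pos_nonneg j i
  constructor <;> linarith

theorem sum_sum_mul_neg_mul_neg (h : IsBalancedPair P N)
    (hneg : ∀ i j, N i j = 1 → ((P - N) * (P - N)) i j = b) :
    ∑ i, ∑ j, P i j * (N * N) i j = -b * Fintype.card V := by
  have h1 : ∑ i, ∑ j, N i j * (N * P) i j + ∑ i, ∑ j, N i j * (N * P) j i =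
      -b * ∑ i, ∑ j, N i j := by
    simp only [mul_sum, ← sum_add_distrib]
    refine sum_congr rfl fun i _ => sum_congr rfl fun j _ => ?_
    rcases h.neg_mem i j with hij | hij
    · simp [hij]
    · rw [hij, ← h.neg_param_eq hneg hij]
      ring
  have h2 : ∑ i, ∑ j, N i j * (N * P) j i = ∑ i, ∑ j, N i j * (N * P) i j := by
    rw [sum_comm]
    exact sum_congr rfl fun i _ => sum_congr rfl fun j _ => by rw [h.neg_symm]
  rw [h2, h.sum_sum_mul_neg_mul_pos, h.sum_sum_neg] at h1
  linarith

theorem sum_nonadj (h : IsBalancedPair P N) [DecidableEq V] (i : V) :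
    ∑ j, (1 - (if i = j then 1 else 0) - P i j - N i j) = (Fintype.card V : ℤ) - 7 := by
  simp only [sum_sub_distrib, h.pos_sum, h.neg_sum]
  simp
  ring

theorem sum_sq_apply (h : IsBalancedPair P N) (i : V) :
    ∑ j, ((P - N) * (P - N)) i j = 4 := by
  have hrow (k : V) : ∑ j, (P - N) k j = 2 := by
    simp [sum_sub_distrib, h.pos_sum, h.neg_sum]
  simp only [Matrix.mul_apply]
  rw [sum_comm]
  simp only [← mul_sum, hrow, ← sum_mul]
  norm_num

/-- The row sums of the square of the signed adjacency matrix. -/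
theorem param_eq (h : IsBalancedPair P N) (i : V)
    (hdiag : ((P - N) * (P - N)) i i = 6)
    (hpos : ∀ i j, P i j = 1 → ((P - N) * (P - N)) i j = a)
    (hneg : ∀ i j, N i j = 1 → ((P - N) * (P - N)) i j = b)
    (hnon : ∀ i j, i ≠ j → P i j = 0 → N i j = 0 → ((P - N) * (P - N)) i j = c) :
    c * ((Fintype.card V : ℤ) - 7) = -2 - 4 * a - 2 * b := by
  classical
  have key (j : V) : ((P - N) * (P - N)) i j = (if i = j then 6 else 0) + a * P i j + b * N i j +
      c * (1 - (if i = j then 1 else 0) - P i j - N i j) := by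
    have hd := h.disjoint i j
    rcases h.pos_mem i j with hp | hp <;> rcases h.neg_mem i j with hn | hn
    · by_cases hij : i = j
      · subst hij
        simp [hdiag, h.pos_diag, h.neg_diag]
      · simp [hnon i j hij hp hn, hij, hp, hn]
    · have hij : i ≠ j := by rintro rfl; simp [h.neg_diag] at hn
      simp [hneg i j hn, hp, hn, hij]
    · have hij : i ≠ j := by rintro rfl; simp [h.pos_diag] at hp
      simp [hpos i j hp, hp, hn, hij]
    · simp [hp, hn] at hd
  have hs := h.sum_sq_apply i
  simp only [key, sum_add_distrib, ← mul_sum, h.pos_sum, h.neg_sum, h.sum_nonadj] at hs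
  simp only [sum_ite_eq, mem_univ, if_true] at hs
  linarith

theorem nonadj_nonneg (h : IsBalancedPair P N) [DecidableEq V] (i j : V) :
    0 ≤ 1 - (if i = j then 1 else 0) - P i j - N i j := by
  have hd := h.disjoint i j
  by_cases hij : i = j
  · subst hij
    simp [h.pos_diag, h.neg_diag]
  · rcases h.pos_mem i j with hp | hp <;> rcases h.neg_mem i j with hn | hn <;>
      simp_all

theorem seven_le_card (h : IsBalancedPair P N) (i : V) : (7 : ℤ) ≤ Fintype.card V := by
  classical
  have := sum_nonneg fun j (_ : j ∈ univ) => h.nonadj_nonneg i j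
  rw [h.sum_nonadj] at this
  linarith

theorem neg_four_le_sq_apply (h : IsBalancedPair P N) (i j : V) :
    -4 ≤ ((P - N) * (P - N)) i j := by
  rw [h.sub_mul_sub_apply]
  linarith [h.pos_mul_pos_nonneg i j, h.neg_mul_neg_nonneg i j, h.neg_mul_pos_le_two i j,
    h.neg_mul_pos_le_two j i]

theorem nonadj_param_ne_neg_four (h : IsBalancedPair P N) (hV : 0 < Fintype.card V)
    (hneg : ∀ i j, N i j = 1 → ((P - N) * (P - N)) i j = -1) :
    ¬ ∀ i j, i ≠ j → P i j = 0 → N i j = 0 → ((P - N) * (P - N)) i j = -4 := by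
  classical
  intro hnon
  have key (i j : V) : (N * P) i j = N i j * (N * P) i j +
      2 * (1 - (if i = j then 1 else 0) - P i j - N i j) := by
    have hd := h.disjoint i j
    rcases h.pos_mem i j with hp | hp <;> rcases h.neg_mem i j with hn | hn
    · by_cases hij : i = j
      · subst hij
        simp [h.neg_mul_pos_diag, h.pos_diag, h.neg_diag]
      · have := hnon i j hij hp hn
        rw [h.sub_mul_sub_apply] at this
        have : (N * P) i j = 2 := by
          linarith [h.pos_mul_pos_nonneg i j, h.neg_mul_neg_nonneg i j,
            h.neg_mul_pos_le_two i j, h.neg_mul_pos_le_two j i]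
        simp [this, hij, hp, hn]
    · have hij : i ≠ j := by rintro rfl; simp [h.neg_diag] at hn
      simp [hp, hn, hij]
    · have hij : i ≠ j := by rintro rfl; simp [h.pos_diag] at hp
      simp [h.neg_mul_pos_eq_zero hp, hp, hn, hij]
    · simp [hp, hn] at hd
  have hs := h.sum_sum_neg_mul_pos
  rw [sum_congr rfl fun i _ => sum_congr rfl fun j _ => key i j] at hs
  simp only [sum_add_distrib, ← mul_sum, h.sum_nonadj, h.sum_sum_mul_neg_mul_pos,
    h.sum_sum_mul_neg_mul_neg hneg] at hs
  simp only [sum_const, card_univ, nsmul_eq_mul] at hs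
  have hV' : (Fintype.card V : ℤ) ≠ 0 := by exact_mod_cast hV.ne'
  have : (Fintype.card V : ℤ) * (1 + 2 * (Fintype.card V - 7)) = Fintype.card V * 8 := by
    linarith
  have := mul_left_cancel₀ hV' this
  omega

theorem neg_param_ne_neg_one (h : IsBalancedPair P N)
    (hdiag : ∀ i, ((P - N) * (P - N)) i i = 6)
    (hpos : ∀ i j, P i j = 1 → ((P - N) * (P - N)) i j = a)
    (hneg : ∀ i j, N i j = 1 → ((P - N) * (P - N)) i j = b)
    (hnon : ∀ i j, i ≠ j → P i j = 0 → N i j = 0 → ((P - N) * (P - N)) i j = c)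
    (hncomp : ∃ i j, i ≠ j ∧ P i j = 0 ∧ N i j = 0) : b ≠ -1 := by
  rintro rfl
  obtain ⟨i, j, hij, hp, hn⟩ := hncomp
  have hV : 0 < Fintype.card V := Fintype.card_pos_iff.2 ⟨i⟩
  have hV' : (0 : ℤ) < Fintype.card V := by exact_mod_cast hV
  have hT := h.sum_sum_mul_neg_mul_neg hneg
  have heven := h.even_sum_sum_mul_neg_mul_neg
  rw [hT] at heven
  have ha := h.sum_sum_mul_neg_mul_neg_le hpos
  rw [hT] at ha
  have ha : 0 < a := by
    by_contra! h0
    nlinarith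
  have heq := h.param_eq i (hdiag i) hpos hneg hnon
  have h7 := h.seven_le_card i
  have hc := h.neg_four_le_sq_apply i j
  rw [hnon i j hij hp hn] at hc
  have hc0 : c < 0 := by
    by_contra! h0
    nlinarith
  have hdvd : (4 : ℤ) ∣ c := by
    obtain ⟨m, hm⟩ := heven
    have h2 : IsCoprime (2 : ℤ) ((Fintype.card V : ℤ) - 7) := ⟨4 - m, 1, by linarith⟩
    have h4 : IsCoprime (4 : ℤ) ((Fintype.card V : ℤ) - 7) := h2.pow_left (m := 2)
    exact h4.dvd_of_dvd_mul_right ⟨-a, by linarith⟩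
  obtain rfl : c = -4 := by omega
  exact h.nonadj_param_ne_neg_four hV hneg hnon

end IsBalancedPair

/-- The matrix of the edges of sign `s`. -/
def signPart {V : Type*} (A : Matrix V V ℤ) (s : ℤ) : Matrix V V ℤ :=
  Matrix.of fun i j => if A i j = s then 1 else 0

theorem signPart_apply {V : Type*} (A : Matrix V V ℤ) (s : ℤ) (i j : V) :
    signPart A s i j = if A i j = s then 1 else 0 := rfl

theorem signPart_eq_one {V : Type*} {A : Matrix V V ℤ} {s : ℤ} {i j : V} :
    signPart A s i j = 1 ↔ A i j = s := by
  simp [signPart_apply]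

theorem signPart_sub_signPart {V : Type*} {A : Matrix V V ℤ}
    (hent : ∀ i j, A i j = -1 ∨ A i j = 0 ∨ A i j = 1) :
    signPart A 1 - signPart A (-1) = A := by
  ext i j
  rcases hent i j with h | h | h <;> simp [signPart_apply, h]

theorem isBalancedPair_signPart {V : Type*} [Fintype V] {A : Matrix V V ℤ}
    (hsymm : ∀ i j, A i j = A j i) (hdiag : ∀ i, A i i = 0)
    (hent : ∀ i j, A i j = -1 ∨ A i j = 0 ∨ A i j = 1)
    (hreg : ∀ i, #{j | A i j ≠ 0} = 6) (hnet : ∀ i, ∑ j, A i j = 2)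
    (hbal : ∀ i j k, A i j ≠ 0 → A j k ≠ 0 → A i k ≠ 0 → A i j * A j k * A i k = 1) :
    IsBalancedPair (signPart A 1) (signPart A (-1)) := by
  have hsub (i : V) : ∑ j, signPart A 1 i j - ∑ j, signPart A (-1) i j = 2 := by
    rw [← hnet i, ← sum_sub_distrib]
    exact sum_congr rfl fun j _ => by
      rcases hent i j with h | h | h <;> simp [signPart_apply, h]
  have hadd (i : V) : ∑ j, signPart A 1 i j + ∑ j, signPart A (-1) i j = 6 := by
    have : ((#{j | A i j ≠ 0} : ℕ) : ℤ) = 6 := by rw [hreg i]; rfl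
    rw [← this, ← sum_add_distrib, natCast_card_filter]
    exact sum_congr rfl fun j _ => by
      rcases hent i j with h | h | h <;> simp [signPart_apply, h]
  refine ⟨?_, ?_, ?_, ?_, ?_, ?_, ?_, ?_, ?_, ?_, ?_⟩
  · intro i j; simp [signPart_apply, hsymm i j]
  · intro i j; simp [signPart_apply, hsymm i j]
  · intro i; simp [signPart_apply, hdiag]
  · intro i; simp [signPart_apply, hdiag]
  · intro i j; simp only [signPart_apply]; split_ifs <;> simp
  · intro i j; simp only [signPart_apply]; split_ifs <;> simp
  · intro i j; rcases hent i j with h | h | h <;> simp [signPart_apply, h]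
  · intro i; linarith [hsub i, hadd i]
  · intro i; linarith [hsub i, hadd i]
  · intro i j k
    have := hbal i j k
    simp only [signPart_apply]
    split_ifs <;> simp_all
  · intro i j k
    have := hbal i j k
    simp only [signPart_apply]
    split_ifs <;> simp_all

/-- In a balanced signed graph, if the weighted count of common neighbours of two adjacent vertices
vanishes, then they have no common neighbours. -/
theorem no_common_neighbor_of_sq_apply_eq_zero {V : Type*} [Fintype V] {A : Matrix V V ℤ}
    (hsymm : ∀ i j, A i j = A j i)
    (hbal : ∀ i j k, A i j ≠ 0 → A j k ≠ 0 → A i k ≠ 0 → A i j * A j k * A i k = 1)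
    {i j : V} (hij : A i j ≠ 0) (h0 : (A * A) i j = 0) (k : V) : ¬(A i k ≠ 0 ∧ A j k ≠ 0) := by
  rintro ⟨hik, hjk⟩
  have hnonneg (l : V) : 0 ≤ A i j * (A i l * A l j) := by
    by_cases hil : A i l = 0
    · simp [hil]
    by_cases hjl : A j l = 0
    · simp [hsymm l j, hjl]
    have := hbal i j l hij hjl hil
    rw [hsymm l j]
    linarith
  have hsum : ∑ l, A i j * (A i l * A l j) = 0 := by
    rw [← mul_sum, ← Matrix.mul_apply, h0, mul_zero]
  have h1 := (sum_eq_zero_iff_of_nonneg fun l _ => hnonneg l).1 hsum k (mem_univ k)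
  have h2 := hbal i j k hij hjk hik
  rw [hsymm k j] at h1
  linarith


theorem stmt16 {n : ℕ} (A : Matrix (Fin n) (Fin n) ℤ) (a b c : ℤ)
    (hsymm : ∀ i j, A i j = A j i)
    (hdiag : ∀ i, A i i = 0)
    (hent : ∀ i j, A i j = -1 ∨ A i j = 0 ∨ A i j = 1)
    (hconn : (SimpleGraph.fromRel (fun i j => A i j ≠ 0)).Connected)
    (hncomp : ¬ ∀ i j : Fin n, i ≠ j → A i j ≠ 0)
    (hinhom : (∃ i j, A i j = 1) ∧ (∃ i j, A i j = -1))
    (hreg : ∀ i, (Finset.univ.filter (fun j => A i j ≠ 0)).card = 6)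
    (hnet : ∀ i, ∑ j, A i j = 2)
    (hAA : ∀ i, (A * A) i i = 6)
    (hpos : ∀ i j, A i j = 1 → (A * A) i j = a)
    (hneg : ∀ i j, A i j = -1 → (A * A) i j = b)
    (hnon : ∀ i j, i ≠ j → A i j = 0 → (A * A) i j = c)
    (hclass : ¬(a = -b ∧ c = 0) ∧ ¬(a ≠ -b ∧ 2 * c = a + b))
    (hbal : ∀ i j k : Fin n, A i j ≠ 0 → A j k ≠ 0 → A i k ≠ 0 →
      A i j * A j k * A i k = 1) :
    (a = 0 ∨ a = 1 ∨ a = 2 ∨ a = 3) ∧ (b = -2 ∨ b = 0) ∧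
    (a = 0 → ∀ i j k : Fin n, A i j = 1 → ¬(A i k ≠ 0 ∧ A j k ≠ 0)) ∧
    (b = 0 → ∀ i j k : Fin n, A i j = -1 → ¬(A i k ≠ 0 ∧ A j k ≠ 0)) := by
  obtain ⟨⟨i₀, j₀, h₀⟩, ⟨i₁, j₁, h₁⟩⟩ := hinhom
  have h := isBalancedPair_signPart hsymm hdiag hent hreg hnet hbal
  have hA := signPart_sub_signPart hent
  have hV : 0 < Fintype.card (Fin n) := Fintype.card_pos_iff.2 ⟨i₀⟩
  have hpos' (i j) (hij : signPart A 1 i j = 1) :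
      ((signPart A 1 - signPart A (-1)) * (signPart A 1 - signPart A (-1))) i j = a := by
    rw [hA]
    exact hpos i j (signPart_eq_one.1 hij)
  have hneg' (i j) (hij : signPart A (-1) i j = 1) :
      ((signPart A 1 - signPart A (-1)) * (signPart A 1 - signPart A (-1))) i j = b := by
    rw [hA]
    exact hneg i j (signPart_eq_one.1 hij)
  have hzero (i j) : A i j = 0 ↔ signPart A 1 i j = 0 ∧ signPart A (-1) i j = 0 := by
    rcases hent i j with h | h | h <;> simp [signPart_apply, h]
  have hnon' (i j) (hij : i ≠ j) (hp : signPart A 1 i j = 0) (hn : signPart A (-1) i j = 0) :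
      ((signPart A 1 - signPart A (-1)) * (signPart A 1 - signPart A (-1))) i j = c := by
    rw [hA]
    exact hnon i j hij ((hzero i j).2 ⟨hp, hn⟩)
  have hb1 : b ≠ -1 := by
    refine h.neg_param_ne_neg_one (fun i => by rw [hA, hAA]) hpos' hneg' hnon' ?_
    push Not at hncomp
    obtain ⟨i, j, hij, h0⟩ := hncomp
    exact ⟨i, j, hij, (hzero i j).1 h0⟩
  obtain ⟨hb2, hb0⟩ := h.neg_param_mem_Icc hneg' (signPart_eq_one.2 h₁)
  have ha := h.pos_param_le_three hV hpos'
  have ha0 := h.pos_param_nonneg hpos' (signPart_eq_one.2 h₀)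
  refine ⟨by omega, by omega, fun h0 i j k hij => ?_, fun h0 i j k hij => ?_⟩
  · exact no_common_neighbor_of_sq_apply_eq_zero hsymm hbal (by simp [hij])
      (by rw [hpos i j hij, h0]) k
  · exact no_common_neighbor_of_sq_apply_eq_zero hsymm hbal (by simp [hij])
      (by rw [hneg i j hij, h0]) k
end

section
/- Let A be the adjacency matrix of a connected, non-complete, inhomogeneous, 6-regular and 0 net-regular strongly regular signed graph with parameters (n, 6, a, b, c) lying in the class C1 ∪ C4 ∪ C5. Then: (1) a < 5 and b < 5; (2) if a = 4 then b ≤ -3, and if b = 4 then a ≤ -3; (3) a ≠ -3 and b ≠ -3; (4) a ≥ -4 and b ≥ -4, and if b = -4 then a ≥ 0, and if a = -4 then b ≥ 0; (5) if b = 3 then a ≤ 1, and if a = 3 then b ≤ 1; (6) a ≠ -2 and b ≠ -2; (7) if b = -1 then a ≤ 1, and if a = -1 then b ≤ 1. -/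
open Finset Matrix

/-- A symmetric integer array with zero diagonal has an even sum. -/
lemma even_sum_of_symm_of_diag_zero_s17 {n : ℕ} (f : Fin n → Fin n → ℤ)
    (hs : ∀ k l, f k l = f l k) (hd : ∀ k, f k k = 0) : Even (∑ k, ∑ l, f k l) := by
  rw [← ZMod.intCast_eq_zero_iff_even, ← Fintype.sum_prod_type', Int.cast_sum]
  refine Finset.sum_involution (fun p _ => p.swap) ?_ ?_ (by simp) (by simp)
  · intro p _
    simp only [Prod.fst_swap, Prod.snd_swap]
    rw [hs p.2 p.1, CharTwo.add_self_eq_zero]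
  · rintro ⟨k, l⟩ _ h heq
    simp only [Prod.swap_prod_mk, Prod.mk.injEq] at heq
    apply h
    simp [heq.1, hd]

lemma even_mul_mul_apply_self {n : ℕ} {S T : Matrix (Fin n) (Fin n) ℤ}
    (hS : ∀ i j, S i j = S j i) (hT : ∀ i j, T i j = T j i) (hT0 : ∀ i, T i i = 0) (i : Fin n) :
    Even ((S * T * S) i i) := by
  have h : (S * T * S) i i = ∑ k, ∑ l, S i l * T l k * S k i := by
    simp only [Matrix.mul_apply, Finset.sum_mul]
  rw [h]
  refine even_sum_of_symm_of_diag_zero_s17 _ (fun k l => ?_) (fun k => by simp [hT0])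
  rw [hT l k, hS i l, hS k i]
  ring

/-- Adjacency matrices of a pair of edge-disjoint cubic graphs that commute. -/
structure CommutingCubicPair {n : ℕ} (P N : Matrix (Fin n) (Fin n) ℤ) : Prop where
  symm_left : ∀ i j, P i j = P j i
  symm_right : ∀ i j, N i j = N j i
  diag_left : ∀ i, P i i = 0
  diag_right : ∀ i, N i i = 0
  left_eq : ∀ i j, P i j = 0 ∨ P i j = 1
  right_eq : ∀ i j, N i j = 0 ∨ N i j = 1
  add_le : ∀ i j, P i j + N i j ≤ 1
  sum_left : ∀ i, ∑ j, P i j = 3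
  sum_right : ∀ i, ∑ j, N i j = 3
  comm : P * N = N * P

namespace CommutingCubicPair

variable {n : ℕ} {P N : Matrix (Fin n) (Fin n) ℤ}

protected lemma swap (h : CommutingCubicPair P N) : CommutingCubicPair N P where
  symm_left := h.symm_right
  symm_right := h.symm_left
  diag_left := h.diag_right
  diag_right := h.diag_left
  left_eq := h.right_eq
  right_eq := h.left_eq
  add_le i j := by rw [add_comm]; exact h.add_le i j
  sum_left := h.sum_right
  sum_right := h.sum_left
  comm := h.comm.symm

lemma left_nonneg (h : CommutingCubicPair P N) (i j : Fin n) : 0 ≤ P i j := by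
  rcases h.left_eq i j with h | h <;> omega

lemma right_nonneg (h : CommutingCubicPair P N) (i j : Fin n) : 0 ≤ N i j :=
  h.swap.left_nonneg i j

lemma mul_self_nonneg (h : CommutingCubicPair P N) (i j : Fin n) : 0 ≤ (P * P) i j := by
  rw [Matrix.mul_apply]
  exact Finset.sum_nonneg fun k _ => mul_nonneg (h.left_nonneg i k) (h.left_nonneg k j)

lemma mul_nonneg_apply (h : CommutingCubicPair P N) (i j : Fin n) : 0 ≤ (P * N) i j := by
  rw [Matrix.mul_apply]
  exact Finset.sum_nonneg fun k _ => mul_nonneg (h.left_nonneg i k) (h.right_nonneg k j)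

lemma mul_self_add_mul_le_two (h : CommutingCubicPair P N) {i j : Fin n} (hij : P i j = 1) :
    (P * P) i j + (P * N) i j ≤ 2 := by
  have hsum : ∑ k ∈ univ.erase j, P i k = 2 := by
    have := Finset.add_sum_erase univ (fun k => P i k) (mem_univ j)
    rw [h.sum_left i, hij] at this
    linarith
  rw [← Matrix.add_apply, ← Matrix.mul_add, Matrix.mul_apply,
    ← Finset.add_sum_erase _ _ (mem_univ j), ← hsum, Matrix.add_apply, h.diag_left, h.diag_right]
  simp only [add_zero, mul_zero, zero_add]
  exact Finset.sum_le_sum fun k _ => mul_le_of_le_one_right (h.left_nonneg i k) (h.add_le k j)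

lemma right_mul_self_add_mul_le_three (h : CommutingCubicPair P N) (i j : Fin n) :
    (N * N) i j + (P * N) i j ≤ 3 := by
  rw [h.comm, ← Matrix.add_apply, ← Matrix.mul_add, Matrix.mul_apply, ← h.sum_right i]
  exact Finset.sum_le_sum fun k _ =>
    mul_le_of_le_one_right (h.right_nonneg i k) (h.swap.add_le k j)

lemma mul_left_apply_self_le (h : CommutingCubicPair P N) {M : Matrix (Fin n) (Fin n) ℤ} {m : ℤ}
    (i : Fin n) (hM : ∀ j, P i j = 1 → M i j ≤ m) : (M * P) i i ≤ 3 * m := by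
  rw [Matrix.mul_apply, ← h.sum_left i, Finset.sum_mul]
  refine Finset.sum_le_sum fun j _ => ?_
  rw [h.symm_left j i]
  rcases h.left_eq i j with hj | hj
  · simp [hj]
  · simpa [hj] using hM j hj

lemma le_mul_left_apply_self (h : CommutingCubicPair P N) {M : Matrix (Fin n) (Fin n) ℤ} {m : ℤ}
    (i : Fin n) (hM : ∀ j, P i j = 1 → m ≤ M i j) : 3 * m ≤ (M * P) i i := by
  have := h.mul_left_apply_self_le (M := -M) (m := -m) i fun j hj => by simpa using hM j hj
  rw [Matrix.neg_mul, Matrix.neg_apply] at this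
  linarith

lemma mul_left_apply_self_eq (h : CommutingCubicPair P N) {M : Matrix (Fin n) (Fin n) ℤ} {m : ℤ}
    (i : Fin n) (hM : ∀ j, P i j = 1 → M i j = m) : (M * P) i i = 3 * m :=
  le_antisymm (h.mul_left_apply_self_le i fun j hj => (hM j hj).le)
    (h.le_mul_left_apply_self i fun j hj => (hM j hj).ge)

lemma sub_sq (h : CommutingCubicPair P N) :
    (P - N) * (P - N) = P * P + N * N - (2 : ℤ) • (P * N) := by
  rw [sub_mul, mul_sub, mul_sub, ← h.comm, two_smul]
  abel

lemma parameter_restrictions (h : CommutingCubicPair P N) (i : Fin n) {a b : ℤ}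
    (ha : ∀ j, P i j = 1 → ((P - N) * (P - N)) i j = a)
    (hb : ∀ j, N i j = 1 → ((P - N) * (P - N)) i j = b) :
    Even a ∧ a ≤ 5 ∧ -4 ≤ a ∧ a ≠ -2 ∧ (a = 4 → b ≤ -2) ∧ (a = -4 → 0 ≤ b) := by
  have hPNP : P * P * N = P * N * P := by rw [mul_assoc P N P, ← h.comm, mul_assoc]
  have hNNP : N * N * P = N * P * N := by rw [mul_assoc N P N, h.comm, mul_assoc]
  have hPNN : P * N * N = N * P * N := by rw [h.comm]
  have hsuma := h.mul_left_apply_self_eq i ha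
  have hsumb := h.swap.mul_left_apply_self_eq i hb
  rw [h.sub_sq] at hsuma hsumb
  rw [sub_mul, add_mul, smul_mul_assoc, hNNP] at hsuma
  rw [sub_mul, add_mul, smul_mul_assoc, hPNP, hPNN] at hsumb
  simp only [Matrix.sub_apply, Matrix.add_apply, Matrix.smul_apply, smul_eq_mul] at hsuma hsumb
  obtain ⟨X, hX⟩ := even_mul_mul_apply_self h.symm_left h.symm_left h.diag_left i
  obtain ⟨Y, hY⟩ := even_mul_mul_apply_self h.symm_right h.symm_left h.diag_left i
  obtain ⟨Z, hZ⟩ := even_mul_mul_apply_self h.symm_left h.symm_right h.diag_right i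
  have hlocal : ∀ j, P i j = 1 → 0 ≤ (P * P) i j ∧ 0 ≤ (N * N) i j ∧ 0 ≤ (P * N) i j ∧
      (P * P) i j + (P * N) i j ≤ 2 ∧ (N * N) i j + (P * N) i j ≤ 3 ∧
      (P * P) i j + (N * N) i j - 2 * (P * N) i j = a := fun j hj => by
    refine ⟨h.mul_self_nonneg i j, h.swap.mul_self_nonneg i j, h.mul_nonneg_apply i j,
      h.mul_self_add_mul_le_two hj, h.right_mul_self_add_mul_le_three i j, ?_⟩
    rw [← ha j hj, h.sub_sq, Matrix.sub_apply, Matrix.add_apply, Matrix.smul_apply, smul_eq_mul]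
  have hN3_le : (N * N * N) i i ≤ 3 * 2 := h.swap.mul_left_apply_self_le i fun j hj => by
    have := h.swap.mul_self_add_mul_le_two hj
    have := h.swap.mul_nonneg_apply i j
    omega
  have hN3_nonneg : 3 * 0 ≤ (N * N * N) i i :=
    h.swap.le_mul_left_apply_self i fun j _ => h.swap.mul_self_nonneg i j
  obtain ⟨j, hj⟩ : ∃ j, P i j = 1 := by
    by_contra! hne
    have := h.sum_left i
    rw [Finset.sum_eq_zero fun j _ => (h.left_eq i j).resolve_right (hne j)] at this
    omega
  have hbounds := hlocal j hj
  refine ⟨?_, by omega, by omega, ?_, ?_, ?_⟩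
  · rw [Int.even_iff]
    omega
  · intro h2
    have hPN : (P * N * P) i i = 3 * 1 := h.mul_left_apply_self_eq i fun j hj => by
      have := hlocal j hj
      omega
    omega
  · intro h4
    have hPN : (P * N * P) i i = 3 * 0 := h.mul_left_apply_self_eq i fun j hj => by
      have := hlocal j hj
      omega
    have hNN : 3 * 2 ≤ (N * N * P) i i := h.le_mul_left_apply_self i fun j hj => by
      have := hlocal j hj
      omega
    rw [hNNP] at hNN
    omega
  · intro h4
    have hPN : (P * N * P) i i = 3 * 2 := h.mul_left_apply_self_eq i fun j hj => by
      have := hlocal j hj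
      omega
    have hNN : (N * N * P) i i = 3 * 0 := h.mul_left_apply_self_eq i fun j hj => by
      have := hlocal j hj
      omega
    rw [hNNP] at hNN
    omega

end CommutingCubicPair

/-- If `(P - N)²` is a combination of `1`, `P`, `N` and the all-ones matrix with the coefficients
of `P` and `N` not summing to zero, and `P - N` has zero row and column sums, then `P` and `N`
commute. -/
lemma mul_comm_of_sub_sq_eq {n : ℕ} {P N J : Matrix (Fin n) (Fin n) ℤ} {d α β c : ℤ}
    (hJ : (P - N) * J = 0) (hJ' : J * (P - N) = 0)
    (hsq : (P - N) * (P - N) = d • (1 : Matrix (Fin n) (Fin n) ℤ) + α • P + β • N + c • J)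
    (hαβ : α + β ≠ 0) : P * N = N * P := by
  have key : (P - N) * (d • (1 : Matrix (Fin n) (Fin n) ℤ) + α • P + β • N + c • J) =
      (d • (1 : Matrix (Fin n) (Fin n) ℤ) + α • P + β • N + c • J) * (P - N) := by
    rw [← hsq, mul_assoc]
  simp only [mul_add, add_mul, Matrix.mul_smul, Matrix.smul_mul, hJ, hJ', mul_one, one_mul,
    smul_zero, add_zero] at key
  simp only [sub_mul, mul_sub, smul_sub] at key
  ext i j
  have hij := congrFun (congrFun key i) j
  simp only [Matrix.add_apply, Matrix.sub_apply, Matrix.smul_apply, smul_eq_mul] at hij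
  apply mul_left_cancel₀ hαβ
  linarith

theorem stmt17 {n : ℕ} (A : Matrix (Fin n) (Fin n) ℤ) (a b c : ℤ)
    (hsymm : ∀ i j, A i j = A j i)
    (hdiag : ∀ i, A i i = 0)
    (hent : ∀ i j, A i j = -1 ∨ A i j = 0 ∨ A i j = 1)
    (hconn : (SimpleGraph.fromRel (fun i j => A i j ≠ 0)).Connected)
    (hncomp : ¬ ∀ i j : Fin n, i ≠ j → A i j ≠ 0)
    (hinhom : (∃ i j, A i j = 1) ∧ (∃ i j, A i j = -1))
    (hreg : ∀ i, (Finset.univ.filter (fun j => A i j ≠ 0)).card = 6)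
    (hnet : ∀ i, ∑ j, A i j = 0)
    (hAA : ∀ i, (A * A) i i = 6)
    (hpos : ∀ i j, A i j = 1 → (A * A) i j = a)
    (hneg : ∀ i j, A i j = -1 → (A * A) i j = b)
    (hnon : ∀ i j, i ≠ j → A i j = 0 → (A * A) i j = c)
    (hclass : ¬(a = -b ∧ c = 0) ∧ ¬(a ≠ -b ∧ 2 * c = a + b)) :
    (a < 5 ∧ b < 5) ∧
    ((a = 4 → b ≤ -3) ∧ (b = 4 → a ≤ -3)) ∧
    (a ≠ -3 ∧ b ≠ -3) ∧
    ((-4 ≤ a ∧ -4 ≤ b) ∧ (b = -4 → 0 ≤ a) ∧ (a = -4 → 0 ≤ b)) ∧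
    ((b = 3 → a ≤ 1) ∧ (a = 3 → b ≤ 1)) ∧
    (a ≠ -2 ∧ b ≠ -2) ∧
    ((b = -1 → a ≤ 1) ∧ (a = -1 → b ≤ 1)) := by
  set P : Matrix (Fin n) (Fin n) ℤ := Matrix.of fun i j => if A i j = 1 then 1 else 0
  set N : Matrix (Fin n) (Fin n) ℤ := Matrix.of fun i j => if A i j = -1 then 1 else 0
  have hPA : ∀ i j, P i j = if A i j = 1 then 1 else 0 := fun i j => rfl
  have hNA : ∀ i j, N i j = if A i j = -1 then 1 else 0 := fun i j => rfl
  have hA : A = P - N := by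
    ext i j
    rw [Matrix.sub_apply, hPA, hNA]
    rcases hent i j with h | h | h <;> simp [h]
  have hadd : ∀ i, ∑ j, P i j + ∑ j, N i j = 6 := fun i => by
    rw [← Finset.sum_add_distrib, ← Nat.cast_ofNat (n := 6), ← hreg i, Finset.natCast_card_filter]
    refine Finset.sum_congr rfl fun j _ => ?_
    rw [hPA, hNA]
    rcases hent i j with h | h | h <;> simp [h]
  have hsub : ∀ i, ∑ j, P i j - ∑ j, N i j = 0 := fun i => by
    rw [← Finset.sum_sub_distrib, ← hnet i]
    refine Finset.sum_congr rfl fun j _ => ?_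
    rw [← Matrix.sub_apply, ← hA]
  have hcomm : P * N = N * P := by
    refine mul_comm_of_sub_sq_eq (J := Matrix.of fun _ _ => 1) (d := 6 - c) (α := a - c)
      (β := b - c) (c := c) ?_ ?_ ?_ (by omega)
    · rw [← hA]
      ext i j
      simpa [Matrix.mul_apply] using hnet i
    · rw [← hA]
      ext i j
      simpa [Matrix.mul_apply, hsymm _ j] using hnet j
    · rw [← hA]
      ext i j
      simp only [Matrix.add_apply, Matrix.smul_apply, smul_eq_mul, hPA, hNA, Matrix.of_apply]
      rcases eq_or_ne i j with rfl | hij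
      · simp [hAA, hdiag]
      · rcases hent i j with h | h | h
        · simp [hneg i j h, h, hij]
        · simp [hnon i j hij h, h, hij]
        · simp [hpos i j h, h, hij]
  have hpair : CommutingCubicPair P N :=
    { symm_left i j := by rw [hPA, hPA, hsymm]
      symm_right i j := by rw [hNA, hNA, hsymm]
      diag_left i := by simp [hPA, hdiag]
      diag_right i := by simp [hNA, hdiag]
      left_eq i j := by rw [hPA]; split_ifs <;> simp
      right_eq i j := by rw [hNA]; split_ifs <;> simp
      add_le i j := by rw [hPA, hNA]; split_ifs <;> omega
      sum_left i := by have := hadd i; have := hsub i; omega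
      sum_right i := by have := hadd i; have := hsub i; omega
      comm := hcomm }
  obtain ⟨i, -⟩ := hinhom.1
  have ha : ∀ j, P i j = 1 → ((P - N) * (P - N)) i j = a := fun j hj => by
    rw [← hA]
    exact hpos i j (by simpa [hPA] using hj)
  have hb : ∀ j, N i j = 1 → ((P - N) * (P - N)) i j = b := fun j hj => by
    rw [← hA]
    exact hneg i j (by simpa [hNA] using hj)
  have hswap : (P - N) * (P - N) = (N - P) * (N - P) := by
    rw [← neg_sub N P, neg_mul_neg]
  have hra := hpair.parameter_restrictions i ha hb
  have hrb := hpair.swap.parameter_restrictions i (hswap ▸ hb) (hswap ▸ ha)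
  simp only [Int.even_iff] at hra hrb
  omega
end

section
/- Let A be the adjacency matrix of a connected, non-complete, inhomogeneous, 6-regular and 0 net-regular strongly regular signed graph with parameters (n, 6, a, b, c) lying in the class C1 ∪ C4 ∪ C5. If (a, b) = (4, -4), then n = 8 and c = -6. -/
/-- The neighbourhood of `i` in the signed graph with adjacency matrix `A`. -/
def nbhd {n : ℕ} (A : Matrix (Fin n) (Fin n) ℤ) (i : Fin n) : Finset (Fin n) :=
  Finset.univ.filter (fun j => A i j ≠ 0)

section

variable {n : ℕ} {A : Matrix (Fin n) (Fin n) ℤ}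

theorem mem_nbhd {i j : Fin n} : j ∈ nbhd A i ↔ A i j ≠ 0 := by
  simp [nbhd]

theorem mem_nbhd_comm (hsymm : ∀ i j, A i j = A j i) {i j : Fin n} :
    j ∈ nbhd A i ↔ i ∈ nbhd A j := by
  rw [mem_nbhd, mem_nbhd, hsymm]

/-- The signed number of 2-walks is bounded in absolute value by the number of common neighbours. -/
theorem abs_sq_apply_le_card (hsymm : ∀ i j, A i j = A j i)
    (hent : ∀ i j, A i j = -1 ∨ A i j = 0 ∨ A i j = 1) (i j : Fin n) :
    |(A * A) i j| ≤ (nbhd A i ∩ nbhd A j).card := by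
  have hsum : (A * A) i j = ∑ k ∈ nbhd A i ∩ nbhd A j, A i k * A k j := by
    rw [Matrix.mul_apply]
    refine (Finset.sum_subset (Finset.subset_univ _) fun k _ hk => ?_).symm
    by_contra h
    obtain ⟨h1, h2⟩ := mul_ne_zero_iff.mp h
    exact hk (Finset.mem_inter.mpr ⟨mem_nbhd.mpr h1, mem_nbhd.mpr (hsymm k j ▸ h2)⟩)
  rw [hsum]
  refine (Finset.abs_sum_le_sum_abs _ _).trans ?_
  refine (Finset.sum_le_card_nsmul _ _ 1 fun k _ => ?_).trans (by simp)
  rcases hent i k with h | h | h <;> rcases hent k j with h' | h' | h' <;> simp [h, h']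

/-- If adjacent vertices have at least four common neighbours in a 6-regular graph, then so do
vertices at distance two. -/
theorem four_le_card_inter_of_common_nbhd (hsymm : ∀ i j, A i j = A j i)
    (hcard : ∀ i, (nbhd A i).card = 6)
    (hadj : ∀ i j, j ∈ nbhd A i → 4 ≤ (nbhd A i ∩ nbhd A j).card)
    (hdiag : ∀ i, i ∉ nbhd A i) {i j k : Fin n} (hik : i ≠ k) (hnik : k ∉ nbhd A i)
    (hji : j ∈ nbhd A i) (hjk : j ∈ nbhd A k) :
    4 ≤ (nbhd A i ∩ nbhd A k).card := by
  have hij := (mem_nbhd_comm hsymm).mp hji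
  have hkj := (mem_nbhd_comm hsymm).mp hjk
  have hnki := mt (mem_nbhd_comm hsymm).mpr hnik
  set T := ((nbhd A j).erase i).erase k with hT
  have hTcard : T.card = 4 := by
    rw [hT, Finset.card_erase_of_mem (Finset.mem_erase.mpr ⟨hik.symm, hkj⟩),
      Finset.card_erase_of_mem hij, hcard]
  have hsub : ∀ l, i ∉ nbhd A l → k ∉ nbhd A l → nbhd A l ∩ nbhd A j ⊆ T := by
    intro l hi hk x hx
    rw [Finset.mem_inter] at hx
    exact Finset.mem_erase.mpr ⟨fun h => hk (h ▸ hx.1),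
      Finset.mem_erase.mpr ⟨fun h => hi (h ▸ hx.1), hx.2⟩⟩
  have hi : nbhd A i ∩ nbhd A j = T :=
    Finset.eq_of_subset_of_card_le (hsub i (hdiag i) hnik) (hTcard ▸ hadj i j hji)
  have hk : nbhd A k ∩ nbhd A j = T :=
    Finset.eq_of_subset_of_card_le (hsub k hnki (hdiag k)) (hTcard ▸ hadj k j hjk)
  rw [← hTcard]
  refine Finset.card_le_card fun x hx => Finset.mem_inter.mpr ⟨?_, ?_⟩
  · exact (Finset.mem_inter.mp (hi ▸ hx)).1
  · exact (Finset.mem_inter.mp (hk ▸ hx)).1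

/-- In a 6-regular graph whose adjacent vertices have at least four common neighbours, at most
six edges join the neighbourhood of `i` to the vertices outside the closed neighbourhood. -/
theorem sum_card_inter_le_six (hsymm : ∀ i j, A i j = A j i)
    (hcard : ∀ i, (nbhd A i).card = 6)
    (hadj : ∀ i j, j ∈ nbhd A i → 4 ≤ (nbhd A i ∩ nbhd A j).card)
    (hdiag : ∀ i, i ∉ nbhd A i) (i : Fin n) :
    ∑ k ∈ (insert i (nbhd A i))ᶜ, (nbhd A i ∩ nbhd A k).card ≤ 6 := by
  have hswap := Finset.sum_card_bipartiteAbove_eq_sum_card_bipartiteBelow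
    (s := (insert i (nbhd A i))ᶜ) (t := nbhd A i) (fun k j => j ∈ nbhd A k)
  have hl : ∀ k, (nbhd A i ∩ nbhd A k).card =
      ((nbhd A i).bipartiteAbove (fun k j => j ∈ nbhd A k) k).card := by
    intro k
    rw [Finset.bipartiteAbove, Finset.filter_mem_eq_inter]
  simp_rw [hl]
  rw [hswap]
  refine (Finset.sum_le_card_nsmul _ _ 1 fun j hj => ?_).trans (by simp [hcard])
  have hdisj : Disjoint ((insert i (nbhd A i))ᶜ.bipartiteBelow (fun k j => j ∈ nbhd A k) j)
      (nbhd A i ∩ nbhd A j) := by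
    rw [Finset.disjoint_left]
    intro x hx hx'
    simp only [Finset.bipartiteBelow, Finset.mem_filter, Finset.mem_compl, Finset.mem_insert,
      Finset.mem_inter, not_or] at hx hx'
    exact hx.1.2 hx'.1
  have hsub : (insert i (nbhd A i))ᶜ.bipartiteBelow (fun k j => j ∈ nbhd A k) j ∪
      (nbhd A i ∩ nbhd A j) ⊆ (nbhd A j).erase i := by
    intro x hx
    simp only [Finset.bipartiteBelow, Finset.mem_union, Finset.mem_filter, Finset.mem_compl,
      Finset.mem_insert, Finset.mem_inter, not_or] at hx
    rw [Finset.mem_erase]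
    rcases hx with ⟨⟨h1, -⟩, h2⟩ | ⟨h1, h2⟩
    · exact ⟨h1, (mem_nbhd_comm hsymm).mp h2⟩
    · refine ⟨?_, h2⟩
      rintro rfl
      exact hdiag _ h1
  have h := Finset.card_le_card hsub
  rw [Finset.card_union_of_disjoint hdisj,
    Finset.card_erase_of_mem ((mem_nbhd_comm hsymm).mp hj), hcard] at h
  have := hadj i j hj
  omega

end


theorem stmt18 {n : ℕ} (A : Matrix (Fin n) (Fin n) ℤ) (a b c : ℤ)
    (hsymm : ∀ i j, A i j = A j i)
    (hdiag : ∀ i, A i i = 0)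
    (hent : ∀ i j, A i j = -1 ∨ A i j = 0 ∨ A i j = 1)
    (hconn : (SimpleGraph.fromRel (fun i j => A i j ≠ 0)).Connected)
    (hncomp : ¬ ∀ i j : Fin n, i ≠ j → A i j ≠ 0)
    (hinhom : (∃ i j, A i j = 1) ∧ (∃ i j, A i j = -1))
    (hreg : ∀ i, (Finset.univ.filter (fun j => A i j ≠ 0)).card = 6)
    (hnet : ∀ i, ∑ j, A i j = 0)
    (hAA : ∀ i, (A * A) i i = 6)
    (hpos : ∀ i j, A i j = 1 → (A * A) i j = a)
    (hneg : ∀ i j, A i j = -1 → (A * A) i j = b)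
    (hnon : ∀ i j, i ≠ j → A i j = 0 → (A * A) i j = c)
    (hclass : ¬(a = -b ∧ c = 0) ∧ ¬(a ≠ -b ∧ 2 * c = a + b))
    (hab : a = 4 ∧ b = -4) :
    n = 8 ∧ c = -6 := by
  obtain ⟨rfl, rfl⟩ := hab
  have hc : c ≠ 0 := fun h => hclass.1 ⟨by norm_num, h⟩
  have hcard : ∀ i, (nbhd A i).card = 6 := hreg
  have hloop : ∀ i, i ∉ nbhd A i := fun i h => mem_nbhd.mp h (hdiag i)
  have hadj : ∀ i j, j ∈ nbhd A i → 4 ≤ (nbhd A i ∩ nbhd A j).card := by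
    intro i j hij
    have h := abs_sq_apply_le_card hsymm hent i j
    rcases hent i j with h' | h' | h'
    · rw [hneg i j h', abs_neg] at h
      exact_mod_cast h
    · exact absurd h' (mem_nbhd.mp hij)
    · rw [hpos i j h'] at h
      exact_mod_cast h
  push Not at hncomp
  obtain ⟨i, k, hik, hAik⟩ := hncomp
  have hfar : ∀ l ∈ (insert i (nbhd A i))ᶜ, 4 ≤ (nbhd A i ∩ nbhd A l).card := by
    intro l hl
    simp only [Finset.mem_compl, Finset.mem_insert, not_or] at hl
    have h := abs_sq_apply_le_card hsymm hent i l
    rw [hnon i l (Ne.symm hl.1) (not_not.mp (mt mem_nbhd.mpr hl.2))] at h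
    have hne : 0 < (nbhd A i ∩ nbhd A l).card := by
      exact_mod_cast (abs_pos.mpr hc).trans_le h
    obtain ⟨j, hj⟩ := Finset.card_pos.mp hne
    rw [Finset.mem_inter] at hj
    exact four_le_card_inter_of_common_nbhd hsymm hcard hadj hloop (Ne.symm hl.1) hl.2 hj.1 hj.2
  have hk : k ∈ (insert i (nbhd A i))ᶜ := by
    simp [hik.symm, mem_nbhd, hAik]
  have hone : (insert i (nbhd A i))ᶜ.card = 1 := by
    have h1 := Finset.card_nsmul_le_sum _ _ _ hfar
    have h2 := sum_card_inter_le_six hsymm hcard hadj hloop i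
    have h3 := Finset.card_pos.mpr ⟨k, hk⟩
    rw [smul_eq_mul] at h1
    omega
  have hn : n = 8 := by
    have h := Finset.card_add_card_compl (insert i (nbhd A i))
    rw [hone, Finset.card_insert_of_notMem (hloop i), hcard, Fintype.card_fin] at h
    omega
  refine ⟨hn, ?_⟩
  have hentry : ∀ l, (A * A) i l =
      4 * A i l + (if l = i then 6 else 0) + (if l ∈ (insert i (nbhd A i))ᶜ then c else 0) := by
    intro l
    by_cases hl : l = i
    · subst hl
      simp [hAA, hdiag]
    · rcases hent i l with h | h | h
      · simp [hneg i l h, h, hl, mem_nbhd]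
      · simp [hnon i l (Ne.symm hl) h, h, hl, mem_nbhd]
      · simp [hpos i l h, h, hl, mem_nbhd]
  have hrow : ∑ l, (A * A) i l = 0 := by
    simp_rw [Matrix.mul_apply]
    rw [Finset.sum_comm]
    simp_rw [← Finset.mul_sum, hnet]
    simp
  simp_rw [hentry] at hrow
  rw [Finset.sum_add_distrib, Finset.sum_add_distrib, ← Finset.mul_sum, hnet,
    Finset.sum_ite_eq' Finset.univ i, ← Finset.sum_filter, Finset.filter_univ_mem,
    Finset.sum_const, hone] at hrow
  simp at hrow
  omega
end

section
/- Let A be the adjacency matrix of a connected, non-complete, inhomogeneous, 6-regular and 0 net-regular strongly regular signed graph with parameters (n, 6, a, b, c) lying in the class C1 ∪ C4 ∪ C5. If (a, b) = (2, 2), then n = 16, c = -2, the graph on the same vertex set whose edges are the pairs {i, j} with A i j = 1 is a disjoint union of four copies of K₄, and the graph whose edges are the pairs {i, j} with A i j = -1 is a disjoint union of four copies of K₄. -/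
/-- A symmetric irreflexive relation that is transitive on distinct vertices and `d`-regular
is a disjoint union of copies of the complete graph on `d + 1` vertices. -/
theorem exists_finpartition_of_regular_of_trans {V : Type*} [Fintype V] [DecidableEq V]
    (R : V → V → Prop) [DecidableRel R] (d : ℕ)
    (symm : ∀ i j, R i j → R j i) (irrefl : ∀ i, ¬ R i i)
    (trans : ∀ i j k, R i j → R j k → i ≠ k → R i k)
    (card : ∀ i, (Finset.univ.filter (fun j => R i j)).card = d) :
    ∃ P : Finpartition (Finset.univ : Finset V),
      (d + 1) * P.parts.card = Fintype.card V ∧ (∀ s ∈ P.parts, s.card = d + 1) ∧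
      (∀ i j : V, R i j ↔ i ≠ j ∧ ∃ s ∈ P.parts, i ∈ s ∧ j ∈ s) := by
  let r : Setoid V :=
    { r := fun i j => i = j ∨ R i j
      iseqv :=
        { refl := fun i => Or.inl rfl
          symm := by grind
          trans := by grind } }
  have : DecidableRel r.r := fun i j => inferInstanceAs (Decidable (i = j ∨ R i j))
  let P := Finpartition.ofSetoid r
  have hpart : ∀ i, P.part i = insert i (Finset.univ.filter (fun j => R i j)) := by
    intro i
    ext j
    rw [Finpartition.mem_part_ofSetoid_iff_rel]
    change (i = j ∨ R i j) ↔ _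
    simp [eq_comm]
  have hcard : ∀ s ∈ P.parts, s.card = d + 1 := by
    intro s hs
    obtain ⟨i, hi⟩ := P.nonempty_of_mem_parts hs
    rw [← P.part_eq_of_mem hs hi, hpart, Finset.card_insert_of_notMem (by simp [irrefl]), card]
  refine ⟨P, ?_, hcard, fun i j => ⟨fun h => ⟨?_, P.part i, ?_, ?_, ?_⟩, ?_⟩⟩
  · rw [← Finset.card_univ, ← P.sum_card_parts, Finset.sum_congr rfl hcard, Finset.sum_const,
      smul_eq_mul, mul_comm]
  · rintro rfl
    exact irrefl _ h
  · simp
  · simp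
  · simp [hpart, h]
  · rintro ⟨hij, s, hs, hi, hj⟩
    rw [← P.part_eq_of_mem hs hi, hpart] at hj
    simpa [hij.symm] using hj

/-- In a net-regular signed graph of degree `6` and net-degree `0`, if every two adjacent vertices
have entry `2` in the square of the adjacency matrix, then a two-step walk joins adjacent vertices
when its edges have equal signs, and non-adjacent ones otherwise. -/
theorem walk_signs {V : Type*} [Fintype V] [DecidableEq V] (A : Matrix V V ℤ) (c : ℤ)
    (habs : ∀ i, ∑ j, |A i j| = 6) (hnet : ∀ i, ∑ j, A i j = 0)
    (hent : ∀ i j, A i j = -1 ∨ A i j = 0 ∨ A i j = 1)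
    (hdiag : ∀ i, A i i = 0)
    (hAA : ∀ i, (A * A) i i = 6)
    (hadj : ∀ i j, A i j ≠ 0 → (A * A) i j = 2)
    (hnon : ∀ i j, i ≠ j → A i j = 0 → (A * A) i j = c) (i : V) :
    c * (Fintype.card V - 7) = -18 ∧
      (∀ j, A i j ≠ 0 → ∀ k, 0 ≤ A i k * A k j) ∧
      (∀ j, i ≠ j → A i j = 0 → ∀ k, A i k * A k j ≤ 0) := by
  let δ : V → ℤ := fun j => 1 - (if i = j then 1 else 0) - |A i j|
  let q : V → ℤ := fun j => ∑ k, |A i k * A k j|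
  have hδ : ∑ j, δ j = Fintype.card V - 7 := by
    simp only [δ, Finset.sum_sub_distrib, habs, Finset.sum_ite_eq, Finset.mem_univ, if_true]
    simp
    ring
  have hsq : ∀ j, (A * A) i j = 6 * (if i = j then 1 else 0) + 2 * |A i j| + c * δ j := by
    intro j
    by_cases hij : i = j
    · subst hij
      simp [δ, hAA, hdiag]
    · rcases hent i j with h | h | h
      · simp [δ, hij, h, hadj i j (by simp [h])]
      · simp [δ, hij, h, hnon i j hij h]
      · simp [δ, hij, h, hadj i j (by simp [h])]
  have hsum : ∑ j, (A * A) i j = 0 := by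
    simp only [Matrix.mul_apply]
    rw [Finset.sum_comm]
    simp [← Finset.mul_sum, hnet]
  have hq : ∑ j, q j = 36 := by
    simp only [q]
    rw [Finset.sum_comm]
    simp [abs_mul, ← Finset.mul_sum, habs, ← Finset.sum_mul]
  have hc : c * (Fintype.card V - 7) = -18 := by
    simp only [hsq, Finset.sum_add_distrib, ← Finset.mul_sum, habs, hδ, Finset.sum_ite_eq,
      Finset.mem_univ, if_true] at hsum
    linarith
  have hle : ∀ j, |(A * A) i j| ≤ q j := fun j => by
    rw [Matrix.mul_apply]
    exact Finset.abs_sum_le_sum_abs _ _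
  have hnonneg : ∀ j ∈ Finset.univ, 0 ≤ q j - (A * A) i j + 2 * c * δ j := by
    intro j _
    have h := abs_le.mp (hle j)
    by_cases hij : i = j
    · subst hij
      simp only [δ, hdiag, if_true, abs_zero]
      linarith
    · rcases hent i j with h0 | h0 | h0
      · simp [δ, hij, h0]
        linarith
      · have := hnon i j hij h0
        simp [δ, hij, h0]
        linarith
      · simp [δ, hij, h0]
        linarith
  have hzero : ∑ j, (q j - (A * A) i j + 2 * c * δ j) = 0 := by
    rw [Finset.sum_add_distrib, Finset.sum_sub_distrib, hq, hsum, ← Finset.mul_sum, hδ]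
    linarith
  have heq := (Finset.sum_eq_zero_iff_of_nonneg hnonneg).mp hzero
  refine ⟨hc, fun j hj k => ?_, fun j hij hj k => ?_⟩
  · have hij : i ≠ j := by
      rintro rfl
      exact hj (hdiag i)
    have hδj : δ j = 0 := by
      rcases hent i j with h | h | h <;> simp_all [δ]
    have h := heq j (Finset.mem_univ j)
    rw [hδj, mul_zero, add_zero, Matrix.mul_apply, ← Finset.sum_sub_distrib,
      Finset.sum_eq_zero_iff_of_nonneg fun k _ => sub_nonneg.mpr (le_abs_self _)] at h
    have := h k (Finset.mem_univ k)
    exact abs_eq_self.mp (by linarith)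
  · have hδj : δ j = 1 := by simp [δ, hij, hj]
    have h := heq j (Finset.mem_univ j)
    have h' : q j + (A * A) i j = 0 := by
      have := hnon i j hij hj
      rw [hδj] at h
      linarith
    rw [Matrix.mul_apply, ← Finset.sum_add_distrib,
      Finset.sum_eq_zero_iff_of_nonneg fun k _ => by
        have := neg_abs_le (A i k * A k j)
        linarith] at h'
    have := h' k (Finset.mem_univ k)
    exact abs_eq_neg_self.mp (by linarith)


theorem stmt19 {n : ℕ} (A : Matrix (Fin n) (Fin n) ℤ) (a b c : ℤ)
    (hsymm : ∀ i j, A i j = A j i)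
    (hdiag : ∀ i, A i i = 0)
    (hent : ∀ i j, A i j = -1 ∨ A i j = 0 ∨ A i j = 1)
    (hconn : (SimpleGraph.fromRel (fun i j => A i j ≠ 0)).Connected)
    (hncomp : ¬ ∀ i j : Fin n, i ≠ j → A i j ≠ 0)
    (hinhom : (∃ i j, A i j = 1) ∧ (∃ i j, A i j = -1))
    (hreg : ∀ i, (Finset.univ.filter (fun j => A i j ≠ 0)).card = 6)
    (hnet : ∀ i, ∑ j, A i j = 0)
    (hAA : ∀ i, (A * A) i i = 6)
    (hpos : ∀ i j, A i j = 1 → (A * A) i j = a)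
    (hneg : ∀ i j, A i j = -1 → (A * A) i j = b)
    (hnon : ∀ i j, i ≠ j → A i j = 0 → (A * A) i j = c)
    (hclass : ¬(a = -b ∧ c = 0) ∧ ¬(a ≠ -b ∧ 2 * c = a + b))
    (hab : a = 2 ∧ b = 2) :
    n = 16 ∧ c = -2 ∧
    (∃ P : Finpartition (Finset.univ : Finset (Fin n)),
      P.parts.card = 4 ∧ (∀ s ∈ P.parts, s.card = 4) ∧
      (∀ i j : Fin n, A i j = 1 ↔ i ≠ j ∧ ∃ s ∈ P.parts, i ∈ s ∧ j ∈ s)) ∧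
    (∃ Q : Finpartition (Finset.univ : Finset (Fin n)),
      Q.parts.card = 4 ∧ (∀ s ∈ Q.parts, s.card = 4) ∧
      (∀ i j : Fin n, A i j = -1 ↔ i ≠ j ∧ ∃ s ∈ Q.parts, i ∈ s ∧ j ∈ s)) := by
  obtain ⟨rfl, rfl⟩ := hab
  have habs : ∀ i, ∑ j, |A i j| = 6 := by
    intro i
    have h : ∀ j, |A i j| = if A i j ≠ 0 then 1 else 0 := by
      intro j
      rcases hent i j with h | h | h <;> simp [h]
    simp_rw [h]
    rw [Finset.sum_boole, hreg]
    rfl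
  have hadj : ∀ i j, A i j ≠ 0 → (A * A) i j = 2 := by
    intro i j h
    rcases hent i j with h' | h' | h'
    · exact hneg i j h'
    · exact absurd h' h
    · exact hpos i j h'
  have hwalk := walk_signs A c habs hnet hent hdiag hAA hadj hnon
  have hcard : ∀ ε : ℤ, ε = 1 ∨ ε = -1 →
      ∀ i, (Finset.univ.filter (fun j => A i j = ε)).card = 3 := by
    intro ε hε i
    have h : ∀ j, 2 * (if A i j = ε then (1 : ℤ) else 0) = |A i j| + ε * A i j := by
      intro j
      rcases hε with rfl | rfl <;> rcases hent i j with h | h | h <;> simp [h]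
    have h' := Finset.sum_congr rfl fun j (_ : j ∈ Finset.univ) => h j
    rw [← Finset.mul_sum, Finset.sum_boole, Finset.sum_add_distrib, habs, ← Finset.mul_sum,
      hnet] at h'
    lia
  have hpart : ∀ ε : ℤ, ε = 1 ∨ ε = -1 → ∃ P : Finpartition (Finset.univ : Finset (Fin n)),
      4 * P.parts.card = n ∧ (∀ s ∈ P.parts, s.card = 4) ∧
      (∀ i j : Fin n, A i j = ε ↔ i ≠ j ∧ ∃ s ∈ P.parts, i ∈ s ∧ j ∈ s) := by
    intro ε hε
    have hε0 : ε ≠ 0 := by rcases hε with rfl | rfl <;> decide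
    let _ : DecidableRel fun i j => A i j = ε := fun i j => inferInstance
    have h := exists_finpartition_of_regular_of_trans (fun i j => A i j = ε) 3
      (fun i j h => hsymm j i ▸ h) (fun i h => hε0 (h ▸ hdiag i)) ?_ (hcard ε hε)
    · simpa using h
    · intro i j k hij hjk hik
      have h1 := (hwalk i).2.2 k hik
      have h2 := (hwalk i).2.1 j (by simpa [hij] using hε0) k
      have h3 := fun h => h1 h j
      rw [hsymm k j, hjk] at h2
      rw [hij, hjk] at h3
      rcases hε with rfl | rfl <;> rcases hent i k with h | h | h <;> simp_all
  obtain ⟨P, hP, hP4, hPA⟩ := hpart 1 (Or.inl rfl)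
  obtain ⟨Q, hQ, hQ4, hQA⟩ := hpart (-1) (Or.inr rfl)
  push Not at hncomp
  obtain ⟨i, j, hij, h0⟩ := hncomp
  have hc := (hwalk i).1
  rw [Fintype.card_fin] at hc
  have hc6 : -6 ≤ c := by
    rw [← hnon i j hij h0, Matrix.mul_apply, ← habs i, ← Finset.sum_neg_distrib]
    refine Finset.sum_le_sum fun k _ => ?_
    rcases hent i k with h | h | h <;> rcases hent k j with h' | h' | h' <;> simp [h, h']
  have hn : 7 ≤ n := by
    have h := Finset.card_lt_univ_of_notMem
      (s := Finset.univ.filter (fun k => A i k ≠ 0)) (x := i) (by simp [hdiag])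
    rw [hreg, Fintype.card_fin] at h
    exact h
  have hc0 : c < 0 := by nlinarith
  have hn16 : n = 16 ∧ c = -2 := by
    interval_cases c <;> omega
  obtain ⟨rfl, rfl⟩ := hn16
  exact ⟨rfl, rfl, ⟨P, by omega, hP4, hPA⟩, ⟨Q, by omega, hQ4, hQA⟩⟩
end
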